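/- arXiv:1706.06039 — 2 statements merged into one kernel-verified Lean document; each statement's English description precedes it below -/
import Mathlib

section
/- Uniform-in-ε L¹ vorticity bound for the second component of plane-parallel channel flow: let u₁^ε solve ∂_t u₁ = ε ∂²_z u₁ on (0,h)×(0,T) with u₁ = 0 at z = 0,h for t > 0 and initial data g₁ ∈ C^∞([0,h]) (not necessarily vanishing at the endpoints). Then ω₂^ε = ∂_z u₁^ε satisfies ‖ω₂^ε(·,t)‖_{L¹(0,h)} ≤ ‖g₁'‖_{L¹(0,h)} + 2‖g₁‖_{L^∞([0,h])} for all 0 ≤ t < T, with constant independent of ε. -/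
open Set MeasureTheory Filter

/-- Partial derivatives of a function that is smooth on a strip, closed in the first variable. -/
theorem exists_partial_derivs_of_contDiffOn_strip {a b c d : ℝ} (hab : a < b) {F : ℝ × ℝ → ℝ}
    (hF : ContDiffOn ℝ (⊤ : ℕ∞) F (Icc a b ×ˢ Ioo c d)) :
    ∃ Fz Ft : ℝ × ℝ → ℝ,
      ContDiffOn ℝ (⊤ : ℕ∞) Fz (Icc a b ×ˢ Ioo c d) ∧
      ContDiffOn ℝ (⊤ : ℕ∞) Ft (Icc a b ×ˢ Ioo c d) ∧
      ∀ z ∈ Icc a b, ∀ t ∈ Ioo c d,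
        HasDerivWithinAt (fun ζ => F (ζ, t)) (Fz (z, t)) (Icc a b) z ∧
        HasDerivAt (fun τ => F (z, τ)) (Ft (z, t)) t := by
  have hU : UniqueDiffOn ℝ (Icc a b ×ˢ Ioo c d) :=
    (uniqueDiffOn_Icc hab).prod isOpen_Ioo.uniqueDiffOn
  have hD : ContDiffOn ℝ (⊤ : ℕ∞) (fderivWithin ℝ F (Icc a b ×ˢ Ioo c d)) (Icc a b ×ˢ Ioo c d) :=
    hF.fderivWithin hU (by simp)
  refine ⟨fun q => fderivWithin ℝ F (Icc a b ×ˢ Ioo c d) q (1, 0),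
    fun q => fderivWithin ℝ F (Icc a b ×ˢ Ioo c d) q (0, 1),
    hD.clm_apply contDiffOn_const, hD.clm_apply contDiffOn_const, fun z hz t ht => ?_⟩
  have hq : HasFDerivWithinAt F (fderivWithin ℝ F (Icc a b ×ˢ Ioo c d) (z, t))
      (Icc a b ×ˢ Ioo c d) (z, t) :=
    ((hF.differentiableOn (by simp)) (z, t) ⟨hz, ht⟩).hasFDerivWithinAt
  constructor
  · exact hq.comp_hasDerivWithinAt z
      ((hasDerivAt_id z).prodMk (hasDerivAt_const z t)).hasDerivWithinAt
      fun ζ hζ => show (ζ, t) ∈ Icc a b ×ˢ Ioo c d from ⟨hζ, ht⟩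
  · exact (hq.comp_hasDerivWithinAt t (s := Ioo c d)
      ((hasDerivAt_const t z).prodMk (hasDerivAt_id t)).hasDerivWithinAt
      fun τ hτ => ⟨hz, hτ⟩).hasDerivAt (Ioo_mem_nhds ht.1 ht.2)

theorem integral_mul_sin_eq_of_hasDerivWithinAt {h m : ℝ} (hh : 0 < h)
    (hm : Real.sin (m * h) = 0) {f f' : ℝ → ℝ}
    (hf : ∀ z ∈ Icc 0 h, HasDerivWithinAt f (f' z) (Icc 0 h) z)
    (hf' : ContinuousOn f' (Icc 0 h)) :
    ∫ z in 0..h, f' z * Real.sin (m * z) = -m * ∫ z in 0..h, f z * Real.cos (m * z) := by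
  have key := intervalIntegral.integral_mul_deriv_eq_deriv_mul_of_hasDerivWithinAt (a := 0) (b := h)
    (u := fun z => Real.sin (m * z)) (u' := fun z => m * Real.cos (m * z)) (v := f) (v' := f')
    (fun z _ => by
      have := ((hasDerivAt_id z).const_mul m).sin
      simpa [mul_comm] using this.hasDerivWithinAt)
    (by rwa [uIcc_of_le hh.le]) (Continuous.intervalIntegrable (by fun_prop) _ _)
    (ContinuousOn.intervalIntegrable (by rwa [uIcc_of_le hh.le]))
  simp only [hm, mul_zero, Real.sin_zero, zero_mul, sub_zero, zero_sub] at key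
  rw [← intervalIntegral.integral_const_mul]
  simp only [neg_mul, intervalIntegral.integral_neg]
  simpa only [mul_comm, mul_left_comm, mul_assoc] using key

theorem integral_mul_cos_eq_of_hasDerivWithinAt {h m : ℝ} (hh : 0 < h) {f f' : ℝ → ℝ}
    (hf : ∀ z ∈ Icc 0 h, HasDerivWithinAt f (f' z) (Icc 0 h) z)
    (hf' : ContinuousOn f' (Icc 0 h)) :
    ∫ z in 0..h, f' z * Real.cos (m * z) =
      f h * Real.cos (m * h) - f 0 + m * ∫ z in 0..h, f z * Real.sin (m * z) := by
  have key := intervalIntegral.integral_mul_deriv_eq_deriv_mul_of_hasDerivWithinAt (a := 0) (b := h)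
    (u := fun z => Real.cos (m * z)) (u' := fun z => -(m * Real.sin (m * z))) (v := f) (v' := f')
    (fun z _ => by
      have := ((hasDerivAt_id z).const_mul m).cos
      simpa [mul_comm] using this.hasDerivWithinAt)
    (by rwa [uIcc_of_le hh.le]) (Continuous.intervalIntegrable (by fun_prop) _ _)
    (ContinuousOn.intervalIntegrable (by rwa [uIcc_of_le hh.le]))
  simp only [mul_zero, Real.cos_zero, one_mul, neg_mul, intervalIntegral.integral_neg,
    sub_neg_eq_add] at key
  rw [← intervalIntegral.integral_const_mul]
  simpa only [mul_comm, mul_left_comm, mul_assoc] using key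

/-- Differentiation of a spatial moment of a function that is `C¹` on a strip. -/
theorem hasDerivAt_integral_mul_of_strip {h T : ℝ} (hh : 0 < h) {U Ut : ℝ × ℝ → ℝ} {φ : ℝ → ℝ}
    (hU : ContinuousOn U (Icc 0 h ×ˢ Ioo 0 T)) (hUt : ContinuousOn Ut (Icc 0 h ×ˢ Ioo 0 T))
    (hφ : Continuous φ)
    (hd : ∀ z ∈ Icc 0 h, ∀ t ∈ Ioo 0 T, HasDerivAt (fun τ => U (z, τ)) (Ut (z, t)) t)
    {t : ℝ} (ht : t ∈ Ioo 0 T) :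
    HasDerivAt (fun τ => ∫ z in 0..h, U (z, τ) * φ z) (∫ z in 0..h, Ut (z, t) * φ z) t := by
  have slice : ∀ {G : ℝ × ℝ → ℝ}, ContinuousOn G (Icc 0 h ×ˢ Ioo 0 T) → ∀ τ ∈ Ioo 0 T,
      IntervalIntegrable (fun z => G (z, τ) * φ z) volume 0 h := fun hG τ hτ => by
    refine ContinuousOn.intervalIntegrable ?_
    rw [uIcc_of_le hh.le]
    exact (hG.comp (by fun_prop : Continuous fun z : ℝ => (z, τ)).continuousOn
      fun z hz => ⟨hz, hτ⟩).mul hφ.continuousOn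
  obtain ⟨a, ha0, hat⟩ := exists_between ht.1
  obtain ⟨b, htb, hbT⟩ := exists_between ht.2
  have hsub : Icc a b ⊆ Ioo 0 T := fun τ hτ => ⟨ha0.trans_le hτ.1, hτ.2.trans_lt hbT⟩
  obtain ⟨C, hC⟩ := (isCompact_Icc.prod (isCompact_Icc (a := a) (b := b))).exists_bound_of_continuousOn
    ((hUt.mul (hφ.comp continuous_fst).continuousOn).mono (prod_mono_right hsub))
  refine (intervalIntegral.hasDerivAt_integral_of_dominated_loc_of_deriv_le
    (F := fun τ z => U (z, τ) * φ z) (F' := fun τ z => Ut (z, τ) * φ z) (bound := fun _ => C)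
    (Icc_mem_nhds hat htb) ?_ (slice hU t ht) (slice hUt t ht).def'.aestronglyMeasurable ?_
    (by simp) ?_).2
  · filter_upwards [Ioo_mem_nhds ht.1 ht.2] with τ hτ
    exact (slice hU τ hτ).def'.aestronglyMeasurable
  · refine Eventually.of_forall fun z hz τ hτ => ?_
    rw [uIoc_of_le hh.le] at hz
    exact hC (z, τ) ⟨Ioc_subset_Icc_self hz, hτ⟩
  · refine Eventually.of_forall fun z hz τ hτ => ?_
    rw [uIoc_of_le hh.le] at hz
    exact (hd z (Ioc_subset_Icc_self hz) τ (hsub hτ)).mul_const _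

theorem integral_cos_add_gaussianReal (m z : ℝ) (v : NNReal) :
    ∫ y, Real.cos (m * (z + y)) ∂ProbabilityTheory.gaussianReal 0 v =
      Real.exp (-(v * m ^ 2 / 2)) * Real.cos (m * z) := by
  have key := ProbabilityTheory.charFun_gaussianReal (μ := 0) (v := v) m
  rw [charFun_apply_real] at key
  have hint : Integrable (fun y : ℝ => Complex.exp (m * z * Complex.I) *
      Complex.exp (m * y * Complex.I)) (ProbabilityTheory.gaussianReal 0 v) := by
    refine Integrable.of_bound (by fun_prop) 1 (Eventually.of_forall fun y => ?_)
    rw [← Complex.exp_add, ← add_mul]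
    exact_mod_cast (Complex.norm_exp_ofReal_mul_I (m * z + m * y)).le
  have hre := integral_re hint
  rw [integral_const_mul, key, ← Complex.exp_add] at hre
  calc _ = ∫ y, RCLike.re (Complex.exp (m * z * Complex.I) *
      Complex.exp (m * y * Complex.I)) ∂ProbabilityTheory.gaussianReal 0 v := by
        congr 1 with y
        rw [← Complex.exp_add, ← add_mul, mul_add, ← Complex.exp_ofReal_mul_I_re]
        simp
    _ = _ := by
        rw [hre]
        have : (m * z * Complex.I + (m * (0 : ℝ) * Complex.I - v * m ^ 2 / 2) : ℂ) =
            ((-(v * m ^ 2 / 2) : ℝ) : ℂ) + ((m * z : ℝ) : ℂ) * Complex.I := by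
          push_cast
          ring
        simp only [this, Complex.exp_add, ← Complex.ofReal_exp, RCLike.re_eq_complex_re,
          Complex.re_ofReal_mul, Complex.exp_ofReal_mul_I_re]

/-- Polynomials in `cos (w z)` are trigonometric polynomials. -/
theorem polynomial_eval_cos_mem_span (w : ℝ) (p : Polynomial ℝ) :
    (fun z => p.eval (Real.cos (w * z))) ∈
      Submodule.span ℝ (range fun (k : ℕ) (z : ℝ) => Real.cos (k * w * z)) := by
  set S := Submodule.span ℝ (range fun (k : ℕ) (z : ℝ) => Real.cos (k * w * z)) with hS
  have hmul : ∀ f ∈ S, (fun z => Real.cos (w * z) * f z) ∈ S := by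
    intro f hf
    induction hf using Submodule.span_induction with
    | mem f hf =>
      obtain ⟨k, rfl⟩ := hf
      have hk : ∀ k : ℕ, (fun z : ℝ => Real.cos (k * w * z)) ∈ S :=
        fun k => Submodule.subset_span ⟨k, rfl⟩
      cases k with
      | zero => simpa using hk 1
      | succ k =>
        convert S.smul_mem (1 / 2 : ℝ) (S.add_mem (hk (k + 2)) (hk k)) using 1
        ext z
        have h1 := Real.cos_add (((k + 1 : ℕ) : ℝ) * w * z) (w * z)
        have h2 := Real.cos_sub (((k + 1 : ℕ) : ℝ) * w * z) (w * z)
        rw [show ((k + 1 : ℕ) : ℝ) * w * z + w * z = ((k + 2 : ℕ) : ℝ) * w * z by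
          push_cast; ring] at h1
        rw [show ((k + 1 : ℕ) : ℝ) * w * z - w * z = (k : ℝ) * w * z by push_cast; ring] at h2
        simp only [Pi.smul_apply, Pi.add_apply, smul_eq_mul, h1, h2]
        ring
    | zero =>
      convert S.zero_mem using 1
      ext z
      simp
    | add f g _ _ hf hg =>
      convert S.add_mem hf hg using 1
      ext z
      simp [mul_add]
    | smul a f _ hf =>
      convert S.smul_mem a hf using 1
      ext z
      simp [mul_left_comm]
  have hpow : ∀ n : ℕ, (fun z => Real.cos (w * z) ^ n) ∈ S := by
    intro n
    induction n with
    | zero => exact Submodule.subset_span ⟨0, by simp⟩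
    | succ n ih => simpa only [pow_succ'] using hmul _ ih
  induction p using Polynomial.induction_on' with
  | add p q hp hq =>
    convert S.add_mem hp hq using 1
    ext z
    simp
  | monomial n a =>
    convert S.smul_mem a (hpow n) using 1
    ext z
    simp

theorem exists_polynomial_cos_near {h η : ℝ} (hh : 0 < h) (hη : 0 < η) {φ : ℝ → ℝ}
    (hφ : ContinuousOn φ (Icc 0 h)) (hb : ∀ z ∈ Icc 0 h, |φ z| ≤ 1) :
    ∃ p : Polynomial ℝ, (∀ x ∈ Icc (-1 : ℝ) 1, |p.eval x| ≤ 1 + η) ∧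
      ∀ z ∈ Icc 0 h, |p.eval (Real.cos (Real.pi / h * z)) - φ z| ≤ η := by
  have hmaps : ∀ x : ℝ, h / Real.pi * Real.arccos x ∈ Icc 0 h := fun x => by
    refine ⟨by have := Real.arccos_nonneg x; positivity, ?_⟩
    calc h / Real.pi * Real.arccos x ≤ h / Real.pi * Real.pi := by
          gcongr
          exact Real.arccos_le_pi x
      _ = h := by field_simp
  obtain ⟨p, hp⟩ := exists_polynomial_near_of_continuousOn (-1) 1
    (fun x => φ (h / Real.pi * Real.arccos x))
    (hφ.comp (by fun_prop) fun x _ => hmaps x) η hη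
  refine ⟨p, fun x hx => ?_, fun z hz => ?_⟩
  · have h1 := hp x hx
    have h2 := hb _ (hmaps x)
    rw [abs_lt] at h1
    rw [abs_le] at h2 ⊢
    constructor <;> linarith
  · have h1 := hp (Real.cos (Real.pi / h * z)) ⟨Real.neg_one_le_cos _, Real.cos_le_one _⟩
    rw [Real.arccos_cos (by have := hz.1; positivity)] at h1
    · rw [show h / Real.pi * (Real.pi / h * z) = z by field_simp] at h1
      exact h1.le
    · calc Real.pi / h * z ≤ Real.pi / h * h := by
            gcongr
            exact hz.2
        _ = Real.pi := by field_simp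

/-- An `L¹` bound on `[0, h]` follows by testing against polynomials in `cos (π z / h)`. -/
theorem integral_abs_le_of_forall_polynomial_cos {h B : ℝ} (hh : 0 < h) {V : ℝ → ℝ}
    (hV : ContinuousOn V (Icc 0 h))
    (H : ∀ (p : Polynomial ℝ) (M : ℝ), (∀ x ∈ Icc (-1 : ℝ) 1, |p.eval x| ≤ M) →
      ∫ z in 0..h, V z * p.eval (Real.cos (Real.pi / h * z)) ≤ B * M) :
    ∫ z in 0..h, |V z| ≤ B := by
  have hI : ∀ {f : ℝ → ℝ}, ContinuousOn f (Icc 0 h) → IntervalIntegrable f volume 0 h :=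
    fun hf => ContinuousOn.intervalIntegrable (by rwa [uIcc_of_le hh.le])
  have main : ∀ η > 0, ∫ z in 0..h, |V z| ≤
      B * (1 + η) + η * h + η * ∫ z in 0..h, |V z| := by
    intro η hη
    have hφ : ContinuousOn (fun z => V z / (|V z| + η)) (Icc 0 h) :=
      hV.div (hV.abs.add continuousOn_const) fun z _ => by positivity
    obtain ⟨p, hpM, hp⟩ := exists_polynomial_cos_near hh hη hφ fun z _ => by
      rw [abs_div, abs_of_pos (by positivity : 0 < |V z| + η), div_le_one (by positivity)]
      linarith
    have hpt : ∀ z ∈ Icc 0 h, |V z| ≤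
        V z * p.eval (Real.cos (Real.pi / h * z)) + η + η * |V z| := by
      intro z hz
      have h1 : |V z| - η ≤ V z * (V z / (|V z| + η)) := by
        rw [← mul_div_assoc, le_div_iff₀ (by positivity), ← abs_mul_abs_self (V z)]
        nlinarith [sq_nonneg η]
      have h2 : V z * (V z / (|V z| + η)) - V z * p.eval (Real.cos (Real.pi / h * z)) ≤
          η * |V z| := by
        rw [← mul_sub]
        refine (le_abs_self _).trans ?_
        rw [abs_mul, mul_comm η, abs_sub_comm]
        exact mul_le_mul_of_nonneg_left (hp z hz) (abs_nonneg _)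
      linarith
    have hVp : IntervalIntegrable (fun z => V z * p.eval (Real.cos (Real.pi / h * z)))
        volume 0 h := hI (hV.mul (by fun_prop))
    calc ∫ z in 0..h, |V z|
        ≤ ∫ z in 0..h, (V z * p.eval (Real.cos (Real.pi / h * z)) + η + η * |V z|) :=
          intervalIntegral.integral_mono_on hh.le (hI hV.abs)
            ((hVp.add (by simp)).add ((hI hV.abs).const_mul η)) hpt
      _ = (∫ z in 0..h, V z * p.eval (Real.cos (Real.pi / h * z))) + η * h +
            η * ∫ z in 0..h, |V z| := by
          rw [intervalIntegral.integral_add (hVp.add (by simp)) ((hI hV.abs).const_mul η),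
            intervalIntegral.integral_add hVp (by simp), intervalIntegral.integral_const_mul]
          simp [mul_comm]
      _ ≤ _ := by
          gcongr
          exact H p _ hpM
  have hlim : Tendsto (fun η : ℝ => B * (1 + η) + η * h + η * ∫ z in 0..h, |V z|)
      (nhdsWithin 0 (Ioi 0)) (nhds B) := by
    refine tendsto_nhdsWithin_of_tendsto_nhds ?_
    have : Continuous fun η : ℝ => B * (1 + η) + η * h + η * ∫ z in 0..h, |V z| := by fun_prop
    simpa using this.tendsto 0
  exact ge_of_tendsto hlim (by filter_upwards [self_mem_nhdsWithin] with η hη using main η hη)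

/-- Evolution of the sine coefficients of a solution of the Dirichlet heat equation. -/
theorem heat_integral_mul_sin_eq {h T ε m : ℝ} (hh : 0 < h) (hm : Real.sin (m * h) = 0)
    {g : ℝ → ℝ} {U Uz Uzz Ut : ℝ × ℝ → ℝ}
    (hU : ContinuousOn U (Icc 0 h ×ˢ Ioo 0 T)) (hUt : ContinuousOn Ut (Icc 0 h ×ˢ Ioo 0 T))
    (hUz : ContinuousOn Uz (Icc 0 h ×ˢ Ioo 0 T)) (hUzz : ContinuousOn Uzz (Icc 0 h ×ˢ Ioo 0 T))
    (hdt : ∀ z ∈ Icc 0 h, ∀ t ∈ Ioo 0 T, HasDerivAt (fun τ => U (z, τ)) (Ut (z, t)) t)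
    (hdz : ∀ z ∈ Icc 0 h, ∀ t ∈ Ioo 0 T,
      HasDerivWithinAt (fun ζ => U (ζ, t)) (Uz (z, t)) (Icc 0 h) z)
    (hdzz : ∀ z ∈ Icc 0 h, ∀ t ∈ Ioo 0 T,
      HasDerivWithinAt (fun ζ => Uz (ζ, t)) (Uzz (z, t)) (Icc 0 h) z)
    (heq : ∀ z ∈ Ioo 0 h, ∀ t ∈ Ioo 0 T, Ut (z, t) = ε * Uzz (z, t))
    (hbdd : ∃ K : ℝ, ∀ z ∈ Icc 0 h, ∀ t ∈ Ioo 0 T, |U (z, t)| ≤ K)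
    (hbc : ∀ t ∈ Ioo 0 T, U (0, t) = 0 ∧ U (h, t) = 0)
    (hic : ∀ z ∈ Ioo 0 h, Tendsto (fun t => U (z, t)) (nhdsWithin 0 (Ioi 0)) (nhds (g z)))
    {t : ℝ} (ht : t ∈ Ioo 0 T) :
    ∫ z in 0..h, U (z, t) * Real.sin (m * z) =
      Real.exp (-(ε * m ^ 2 * t)) * ∫ z in 0..h, g z * Real.sin (m * z) := by
  have slice : ∀ {G : ℝ × ℝ → ℝ}, ContinuousOn G (Icc 0 h ×ˢ Ioo 0 T) → ∀ τ ∈ Ioo 0 T,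
      ContinuousOn (fun z => G (z, τ)) (Icc 0 h) := fun hG τ hτ =>
    hG.comp (by fun_prop : Continuous fun z : ℝ => (z, τ)).continuousOn fun z hz => ⟨hz, hτ⟩
  set c : ℝ → ℝ := fun τ => ∫ z in 0..h, U (z, τ) * Real.sin (m * z) with hc
  have hne : ∀ᵐ z : ℝ, z ≠ h := by simp [ae_iff]
  have hcd : ∀ τ ∈ Ioo 0 T, HasDerivAt c (-(ε * m ^ 2) * c τ) τ := by
    intro τ hτ
    convert hasDerivAt_integral_mul_of_strip hh hU hUt
      (by fun_prop : Continuous fun z : ℝ => Real.sin (m * z)) hdt hτ using 1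
    have h1 : ∫ z in 0..h, Ut (z, τ) * Real.sin (m * z) =
        ε * ∫ z in 0..h, Uzz (z, τ) * Real.sin (m * z) := by
      rw [← intervalIntegral.integral_const_mul]
      refine intervalIntegral.integral_congr_ae ?_
      filter_upwards [hne] with z hz hz'
      rw [uIoc_of_le hh.le] at hz'
      rw [heq z ⟨hz'.1, lt_of_le_of_ne hz'.2 hz⟩ τ hτ, mul_assoc]
    rw [h1, integral_mul_sin_eq_of_hasDerivWithinAt hh hm (fun z hz => hdzz z hz τ hτ)
      (slice hUzz τ hτ), integral_mul_cos_eq_of_hasDerivWithinAt hh (fun z hz => hdz z hz τ hτ)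
      (slice hUz τ hτ), (hbc τ hτ).1, (hbc τ hτ).2, hc]
    ring
  have hed : ∀ τ ∈ Ioo 0 T, HasDerivAt (fun τ => Real.exp (ε * m ^ 2 * τ) * c τ) 0 τ := by
    intro τ hτ
    refine (((hasDerivAt_id τ).const_mul (ε * m ^ 2)).exp.mul (hcd τ hτ)).congr_deriv ?_
    simp only [id]
    ring
  have hconst : ∀ τ ∈ Ioo 0 T,
      Real.exp (ε * m ^ 2 * τ) * c τ = Real.exp (ε * m ^ 2 * t) * c t := fun τ hτ =>
    isOpen_Ioo.is_const_of_deriv_eq_zero isPreconnected_Ioo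
      (fun τ hτ => (hed τ hτ).differentiableAt.differentiableWithinAt)
      (fun τ hτ => (hed τ hτ).deriv) hτ ht
  have hIoo : ∀ᶠ τ in nhdsWithin (0 : ℝ) (Ioi 0), τ ∈ Ioo 0 T :=
    Ioo_mem_nhdsGT (ht.1.trans ht.2)
  obtain ⟨K, hK⟩ := hbdd
  have hclim : Tendsto c (nhdsWithin 0 (Ioi 0)) (nhds (∫ z in 0..h, g z * Real.sin (m * z))) := by
    refine intervalIntegral.tendsto_integral_filter_of_dominated_convergence (fun _ => K) ?_ ?_
      (by simp) ?_
    · filter_upwards [hIoo] with τ hτ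
      refine (ContinuousOn.intervalIntegrable ?_).def'.aestronglyMeasurable
      rw [uIcc_of_le hh.le]
      exact (slice hU τ hτ).mul (by fun_prop)
    · filter_upwards [hIoo] with τ hτ
      refine Eventually.of_forall fun z hz => ?_
      rw [uIoc_of_le hh.le] at hz
      rw [norm_mul, Real.norm_eq_abs, Real.norm_eq_abs]
      exact (mul_le_of_le_one_right (abs_nonneg _) (Real.abs_sin_le_one _)).trans
        (hK z (Ioc_subset_Icc_self hz) τ hτ)
    · filter_upwards [hne] with z hz hz'
      rw [uIoc_of_le hh.le] at hz'
      exact (hic z ⟨hz'.1, lt_of_le_of_ne hz'.2 hz⟩).mul_const _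
  have hexp : Tendsto (fun τ => Real.exp (ε * m ^ 2 * τ)) (nhdsWithin 0 (Ioi 0)) (nhds 1) := by
    refine tendsto_nhdsWithin_of_tendsto_nhds ?_
    have : Continuous fun τ => Real.exp (ε * m ^ 2 * τ) := by fun_prop
    simpa using this.tendsto 0
  have hval := tendsto_nhds_unique (hexp.mul hclim)
    (tendsto_const_nhds.congr' (hIoo.mono fun τ hτ => (hconst τ hτ).symm))
  rw [one_mul] at hval
  rw [hval, ← mul_assoc, ← Real.exp_add, neg_add_cancel, Real.exp_zero, one_mul]

/-- If each cosine moment of `V` is that of `g'` minus boundary terms, damped by a Gaussian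
factor, then the moments of `V` against cosine polynomials are obtained by Gaussian averaging. -/
theorem integral_mul_eq_of_mem_span_cos {h w : ℝ} (hh : 0 < h) {v : NNReal} {V g g' : ℝ → ℝ}
    (hV : ContinuousOn V (Icc 0 h)) (hg' : Continuous g')
    (H : ∀ k : ℕ, ∫ z in 0..h, V z * Real.cos (k * w * z) =
      Real.exp (-(v * (k * w) ^ 2 / 2)) *
        ((∫ z in 0..h, g' z * Real.cos (k * w * z)) - (g h * Real.cos (k * w * h) - g 0)))
    {ψ : ℝ → ℝ}
    (hψ : ψ ∈ Submodule.span ℝ (range fun (k : ℕ) (z : ℝ) => Real.cos (k * w * z))) :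
    ∃ W : ℝ → ℝ, Continuous W ∧
      (∀ z, W z = ∫ y, ψ (z + y) ∂ProbabilityTheory.gaussianReal 0 v) ∧
      ∫ z in 0..h, V z * ψ z = (∫ z in 0..h, g' z * W z) - (g h * W h - g 0 * W 0) := by
  have hI : ∀ {f : ℝ → ℝ}, Continuous f → IntervalIntegrable (fun z => V z * f z) volume 0 h :=
    fun hf => ContinuousOn.intervalIntegrable (by
      rw [uIcc_of_le hh.le]
      exact hV.mul hf.continuousOn)
  suffices Continuous ψ ∧
      (∀ z, Integrable (fun y => ψ (z + y)) (ProbabilityTheory.gaussianReal 0 v)) ∧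
      ∃ W : ℝ → ℝ, Continuous W ∧
      (∀ z, W z = ∫ y, ψ (z + y) ∂ProbabilityTheory.gaussianReal 0 v) ∧
      ∫ z in 0..h, V z * ψ z = (∫ z in 0..h, g' z * W z) - (g h * W h - g 0 * W 0) from this.2.2
  induction hψ using Submodule.span_induction with
  | mem f hf =>
    obtain ⟨k, rfl⟩ := hf
    refine ⟨by fun_prop, fun z => ?_,
      fun z => Real.exp (-(v * (k * w) ^ 2 / 2)) * Real.cos (k * w * z), by fun_prop,
      fun z => (integral_cos_add_gaussianReal _ _ _).symm, ?_⟩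
    · exact Integrable.of_bound (by fun_prop) 1
        (Eventually.of_forall fun y => Real.abs_cos_le_one _)
    · simp only [H k, mul_left_comm (g' _), intervalIntegral.integral_const_mul, mul_zero,
        Real.cos_zero]
      ring
  | zero => exact ⟨continuous_const, by simp, 0, continuous_const, by simp, by simp⟩
  | add f₁ f₂ _ _ h₁ h₂ =>
    obtain ⟨hc₁, hi₁, W₁, hW₁, he₁, hr₁⟩ := h₁
    obtain ⟨hc₂, hi₂, W₂, hW₂, he₂, hr₂⟩ := h₂
    refine ⟨hc₁.add hc₂, fun z => (hi₁ z).add (hi₂ z), W₁ + W₂, hW₁.add hW₂, fun z => ?_, ?_⟩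
    · simp only [Pi.add_apply, integral_add (hi₁ z) (hi₂ z), he₁, he₂]
    · simp only [Pi.add_apply, mul_add]
      rw [intervalIntegral.integral_add (hI hc₁) (hI hc₂),
        intervalIntegral.integral_add (f := fun z => g' z * W₁ z) (g := fun z => g' z * W₂ z)
          ((hg'.mul hW₁).intervalIntegrable _ _) ((hg'.mul hW₂).intervalIntegrable _ _), hr₁, hr₂]
      ring
  | smul a f _ hf =>
    obtain ⟨hc, hi, W, hW, he, hr⟩ := hf
    refine ⟨hc.const_smul a, fun z => (hi z).const_mul a, a • W, hW.const_smul a,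
      fun z => ?_, ?_⟩
    · simp only [Pi.smul_apply, smul_eq_mul, integral_const_mul, he]
    · simp only [Pi.smul_apply, smul_eq_mul, mul_left_comm _ a,
        intervalIntegral.integral_const_mul, hr]
      ring

/-- Uniform-in-ε L¹ vorticity bound for the second vorticity component of
plane-parallel channel flow: if u₁ solves the 1D heat equation on (0,h) with
homogeneous Dirichlet data for t > 0 and (possibly incompatible) smooth initial
data g₁, then ω₂ = ∂_z u₁ satisfies
‖ω₂(·,t)‖_{L¹(0,h)} ≤ ‖g₁'‖_{L¹(0,h)} + 2‖g₁‖_{L^∞([0,h])}. -/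
theorem heat_incompatible_L1_vorticity_bound (h T ε : ℝ)
    (hh : 0 < h) (hT : 0 < T) (hε : 0 < ε)
    (g₁ : ℝ → ℝ) (hg : ContDiff ℝ (⊤ : ℕ∞) g₁)
    (u : ℝ → ℝ → ℝ)
    (hsm : ContDiffOn ℝ (⊤ : ℕ∞) (fun q : ℝ × ℝ => u q.1 q.2) (Icc 0 h ×ˢ Ioo 0 T))
    (hbdd : ∃ K : ℝ, ∀ z ∈ Icc (0 : ℝ) h, ∀ t ∈ Ioo (0 : ℝ) T, |u z t| ≤ K)
    (heq : ∀ z ∈ Ioo (0 : ℝ) h, ∀ t ∈ Ioo (0 : ℝ) T,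
      deriv (fun τ => u z τ) t = ε * deriv (deriv fun ζ => u ζ t) z)
    (hbc : ∀ t ∈ Ioo (0 : ℝ) T, u 0 t = 0 ∧ u h t = 0)
    (hic : ∀ z ∈ Ioo (0 : ℝ) h,
      Tendsto (fun t => u z t) (nhdsWithin 0 (Ioi 0)) (nhds (g₁ z))) :
    ∀ t ∈ Ioo (0 : ℝ) T,
      (∫ z in Ioc (0 : ℝ) h, |deriv (fun ζ => u ζ t) z|) ≤
        (∫ z in Ioc (0 : ℝ) h, |deriv g₁ z|) +
          2 * ⨆ z : Icc (0 : ℝ) h, |g₁ z.1| := by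
  intro t ht
  obtain ⟨Uz, Ut, hUz, hUt, hd⟩ := exists_partial_derivs_of_contDiffOn_strip hh hsm
  obtain ⟨Uzz, _, hUzz, _, hdz⟩ := exists_partial_derivs_of_contDiffOn_strip hh hUz
  have hderiv : ∀ τ ∈ Ioo 0 T, ∀ z ∈ Ioo 0 h, deriv (fun ζ => u ζ τ) z = Uz (z, τ) :=
    fun τ hτ z hz =>
      ((hd z (Ioo_subset_Icc_self hz) τ hτ).1.hasDerivAt (Icc_mem_nhds hz.1 hz.2)).deriv
  have heat : ∀ z ∈ Ioo 0 h, ∀ τ ∈ Ioo 0 T, Ut (z, τ) = ε * Uzz (z, τ) := by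
    intro z hz τ hτ
    rw [← (hd z (Ioo_subset_Icc_self hz) τ hτ).2.deriv]
    refine (heq z hz τ hτ).trans ?_
    rw [EventuallyEq.deriv_eq (eventually_of_mem (Ioo_mem_nhds hz.1 hz.2) (hderiv τ hτ))]
    rw [((hdz z (Ioo_subset_Icc_self hz) τ hτ).1.hasDerivAt (Icc_mem_nhds hz.1 hz.2)).deriv]
  have hne : ∀ᵐ z : ℝ, z ≠ h := by simp [ae_iff]
  have hV : ContinuousOn (fun z => Uz (z, t)) (Icc 0 h) :=
    hUz.continuousOn.comp (by fun_prop : Continuous fun z : ℝ => (z, t)).continuousOn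
      fun z hz => ⟨hz, ht⟩
  have hg' : Continuous (deriv g₁) := hg.continuous_deriv (by simp)
  set G := ⨆ z : Icc (0 : ℝ) h, |g₁ z.1| with hG
  have hGle : ∀ z ∈ Icc 0 h, |g₁ z| ≤ G := by
    obtain ⟨C, hC⟩ := isCompact_Icc.exists_bound_of_continuousOn
      (hg.continuous.continuousOn (s := Icc 0 h))
    exact fun z hz => le_ciSup (f := fun z : Icc (0 : ℝ) h => |g₁ z.1|)
      ⟨C, by rintro _ ⟨y, rfl⟩; exact hC y y.2⟩ ⟨z, hz⟩
  have hlhs : ∫ z in Ioc (0 : ℝ) h, |deriv (fun ζ => u ζ t) z| = ∫ z in 0..h, |Uz (z, t)| := by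
    rw [← intervalIntegral.integral_of_le hh.le]
    refine intervalIntegral.integral_congr_ae ?_
    filter_upwards [hne] with z hz hz'
    rw [uIoc_of_le hh.le] at hz'
    rw [hderiv t ht z ⟨hz'.1, lt_of_le_of_ne hz'.2 hz⟩]
  rw [hlhs, ← intervalIntegral.integral_of_le hh.le]
  have hcoef : ∀ k : ℕ, ∫ z in 0..h, Uz (z, t) * Real.cos (k * (Real.pi / h) * z) =
      Real.exp (-((2 * ε * t).toNNReal * (k * (Real.pi / h)) ^ 2 / 2)) *
        ((∫ z in 0..h, deriv g₁ z * Real.cos (k * (Real.pi / h) * z)) -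
          (g₁ h * Real.cos (k * (Real.pi / h) * h) - g₁ 0)) := by
    intro k
    have hm : Real.sin (k * (Real.pi / h) * h) = 0 := by
      rw [show (k : ℝ) * (Real.pi / h) * h = k * Real.pi by field_simp]
      exact Real.sin_nat_mul_pi k
    rw [integral_mul_cos_eq_of_hasDerivWithinAt hh (fun z hz => (hd z hz t ht).1) hV,
      integral_mul_cos_eq_of_hasDerivWithinAt hh
        (fun z _ => (hg.differentiable (by simp) z).hasDerivAt.hasDerivWithinAt) hg'.continuousOn,
      heat_integral_mul_sin_eq hh hm hsm.continuousOn hUt.continuousOn hUz.continuousOn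
        hUzz.continuousOn (fun z hz τ hτ => (hd z hz τ hτ).2) (fun z hz τ hτ => (hd z hz τ hτ).1)
        (fun z hz τ hτ => (hdz z hz τ hτ).1) heat hbdd hbc hic ht, (hbc t ht).1, (hbc t ht).2,
      Real.coe_toNNReal _ (by have := ht.1; positivity)]
    ring_nf
  refine integral_abs_le_of_forall_polynomial_cos hh hV fun p M hM => ?_
  obtain ⟨W, hWc, hW, hrep⟩ := integral_mul_eq_of_mem_span_cos hh hV hg' hcoef
    (polynomial_eval_cos_mem_span (Real.pi / h) p)
  have hWM : ∀ z, |W z| ≤ M := fun z => by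
    rw [hW z, ← Real.norm_eq_abs]
    refine (norm_integral_le_of_norm_le_const (Eventually.of_forall fun y =>
      hM _ ⟨Real.neg_one_le_cos _, Real.cos_le_one _⟩)).trans (by simp)
  have hM0 : 0 ≤ M := (abs_nonneg _).trans (hWM 0)
  have hint : |∫ z in 0..h, deriv g₁ z * W z| ≤ (∫ z in 0..h, |deriv g₁ z|) * M := by
    rw [← intervalIntegral.integral_mul_const]
    refine (intervalIntegral.abs_integral_le_integral_abs hh.le).trans
      (intervalIntegral.integral_mono_on hh.le
        ((hg'.mul hWc).abs.intervalIntegrable _ _)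
        ((hg'.abs.mul continuous_const).intervalIntegrable _ _) fun z _ => ?_)
    rw [abs_mul]
    exact mul_le_mul_of_nonneg_left (hWM z) (abs_nonneg _)
  have hbd : ∀ z ∈ Icc 0 h, |g₁ z * W z| ≤ G * M := fun z hz => by
    rw [abs_mul]
    exact mul_le_mul (hGle z hz) (hWM z) (abs_nonneg _) ((abs_nonneg _).trans (hGle z hz))
  have h0 := abs_le.1 (hbd 0 ⟨le_rfl, hh.le⟩)
  have h1 := abs_le.1 (hbd h ⟨hh.le, le_rfl⟩)
  rw [hrep]
  linarith [h0.2, h1.1, (abs_le.1 hint).2]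
end

section
/- Divergence-free trace inequality: for a bounded C² domain Ω ⊂ ℝ³, there exists C = C(Ω) such that every vector field v ∈ L²(Ω)³ with div v = 0, v·n = 0 on ∂Ω, and v ∈ H¹(Ω)³ satisfies ‖v‖_{L²(∂Ω)} ≤ C ‖v‖_{L²(Ω)}^{1/2} ‖∇v‖_{L²(Ω)}^{1/2}. -/
open MeasureTheory Set
open scoped ENNReal

open Filter Topology Metric in
lemma exists_norm_fderiv_le_of_contDiffOn_closure {E F : Type*} [NormedAddCommGroup E]
    [NormedSpace ℝ E] [ProperSpace E] [NormedAddCommGroup F] [NormedSpace ℝ F] {Ω : Set E}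
    (hopen : IsOpen Ω) (hbdd : Bornology.IsBounded Ω) {v : E → F}
    (hv : ContDiffOn ℝ 1 v (closure Ω)) :
    ∃ M : ℝ, 0 ≤ M ∧ ∀ x ∈ Ω, ‖fderiv ℝ v x‖ ≤ M := by
  have hK : IsCompact (closure Ω) := hbdd.isCompact_closure
  have key : ∃ M : ℝ, 0 ≤ M ∧ ∀ x ∈ closure Ω ∩ Ω, ‖fderiv ℝ v x‖ ≤ M := by
    refine hK.induction_on (p := fun s => ∃ M : ℝ, 0 ≤ M ∧ ∀ x ∈ s ∩ Ω, ‖fderiv ℝ v x‖ ≤ M)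
      ⟨0, le_rfl, by simp⟩ ?_ ?_ ?_
    · rintro s t hst ⟨M, hM, h⟩
      exact ⟨M, hM, fun x hx => h x ⟨hst hx.1, hx.2⟩⟩
    · rintro s t ⟨M, hM, h⟩ ⟨N, hN, h'⟩
      refine ⟨max M N, le_max_of_le_left hM, ?_⟩
      rintro x ⟨hx | hx, hxΩ⟩
      · exact (h x ⟨hx, hxΩ⟩).trans (le_max_left _ _)
      · exact (h' x ⟨hx, hxΩ⟩).trans (le_max_right _ _)
    · intro x hx
      have h1 : ContDiffWithinAt ℝ (0 + 1) v (closure Ω) x := by simpa using hv x hx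
      obtain ⟨u, hu, -, f', hf', hc⟩ :=
        (contDiffWithinAt_succ_iff_hasFDerivWithinAt (by simp)).1 h1
      rw [insert_eq_of_mem hx] at hu
      have hc' : ContinuousWithinAt f' u x := hc.continuousWithinAt
      have hb : ∀ᶠ y in 𝓝[u] x, ‖f' y‖ < ‖f' x‖ + 1 :=
        hc'.norm.eventually_lt_const (lt_add_one _)
      have hb' : ∀ᶠ y in 𝓝[closure Ω] x, ‖f' y‖ < ‖f' x‖ + 1 :=
        hb.filter_mono (nhdsWithin_le_iff.2 hu)
      obtain ⟨O, hO, hxO, hOs⟩ := mem_nhdsWithin.1 (inter_mem hu hb')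
      refine ⟨closure Ω ∩ O, inter_mem_nhdsWithin _ (hO.mem_nhds hxO), ‖f' x‖ + 1, by positivity, ?_⟩
      rintro y ⟨⟨hy, hyO⟩, hyΩ⟩
      have hun : u ∈ 𝓝 y := mem_of_superset ((hO.inter hopen).mem_nhds ⟨hyO, hyΩ⟩)
        fun z hz => (hOs ⟨hz.1, subset_closure hz.2⟩).1
      rw [((hf' y (mem_of_mem_nhds hun)).hasFDerivAt hun).fderiv]
      exact (hOs ⟨hyO, hy⟩).2.le
  obtain ⟨M, hM, h⟩ := key
  exact ⟨M, hM, fun x hx => h x ⟨subset_closure hx, hx⟩⟩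

open Filter Topology Metric in
/-- At a boundary point touched by an inner ball, vectors tangent to the boundary are orthogonal to
the direction of the centre of the ball. -/
lemma inner_eq_zero_of_ball_subset {E : Type*} [NormedAddCommGroup E] [InnerProductSpace ℝ E]
    {Ω : Set E} {x y : E} (hy : y ∉ Ω) (hball : ball x (dist x y) ⊆ Ω) {f : E → ℝ}
    (hf : DifferentiableAt ℝ f y) (hne : fderiv ℝ f y ≠ 0)
    (hΩ : ∀ᶠ z in 𝓝 y, (z ∈ Ω ↔ f z < 0)) {w : E} (hw : fderiv ℝ f y w = 0) :
    inner ℝ (x - y) w = 0 := by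
  have hfy : 0 ≤ f y := by
    have := hΩ.self_of_nhds
    by_contra! h
    exact hy (this.2 h)
  have hhalf : ∀ u : E, 0 < inner ℝ (x - y) u → fderiv ℝ f y u ≤ 0 := by
    intro u hu
    have hline : HasDerivAt (fun t : ℝ => f (y + t • u)) (fderiv ℝ f y u) 0 := by
      have h0 : HasDerivAt (fun t : ℝ => y + t • u) u 0 := by
        simpa using ((hasDerivAt_id (0 : ℝ)).smul_const u).const_add y
      have h1 : HasFDerivAt f (fderiv ℝ f y) (y + (0 : ℝ) • u) := by simpa using hf.hasFDerivAt
      exact h1.comp_hasDerivAt (0 : ℝ) h0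
    by_contra! hpos
    have hslope := hline.tendsto_slope_zero_right
    have e1 : ∀ᶠ t in 𝓝[>] (0 : ℝ), 0 < t⁻¹ • (f (y + (0 + t) • u) - f (y + (0 : ℝ) • u)) :=
      hslope.eventually_const_lt hpos
    have hcont : Tendsto (fun t : ℝ => y + t • u) (𝓝[>] 0) (𝓝 y) := by
      have : Continuous (fun t : ℝ => y + t • u) := by fun_prop
      simpa using (this.tendsto 0).mono_left nhdsWithin_le_nhds
    have e2 := hcont.eventually hΩ
    have e3 : ∀ᶠ t in 𝓝[>] (0 : ℝ), t * ‖u‖ ^ 2 < 2 * inner ℝ (x - y) u := by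
      have : Continuous (fun t : ℝ => t * ‖u‖ ^ 2) := by fun_prop
      have h0 : Tendsto (fun t : ℝ => t * ‖u‖ ^ 2) (𝓝[>] 0) (𝓝 0) := by
        simpa using (this.tendsto 0).mono_left nhdsWithin_le_nhds
      exact h0.eventually_lt_const (by linarith)
    obtain ⟨t, h1, h2, h3, ht⟩ := (e1.and (e2.and (e3.and self_mem_nhdsWithin))).exists
    have ht : 0 < t := ht
    have hmem : y + t • u ∈ Ω := by
      apply hball
      rw [mem_ball, dist_comm, dist_eq_norm, dist_eq_norm]
      have : x - (y + t • u) = (x - y) - t • u := by abel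
      rw [this]
      refine lt_of_pow_lt_pow_left₀ 2 (norm_nonneg _) ?_
      rw [norm_sub_sq_real, inner_smul_right, norm_smul, mul_pow, Real.norm_eq_abs, sq_abs]
      nlinarith
    have hneg := h2.1 hmem
    simp only [zero_add, zero_smul, add_zero, smul_eq_mul] at h1
    have := (mul_pos_iff_of_pos_left (inv_pos.2 ht)).1 h1
    linarith
  obtain ⟨z, hz⟩ : ∃ z, 0 < fderiv ℝ f y z := by
    obtain ⟨z, hz⟩ : ∃ z, fderiv ℝ f y z ≠ 0 := by
      by_contra! h
      exact hne (ContinuousLinearMap.ext h)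
    rcases lt_or_gt_of_ne hz with h | h
    · exact ⟨-z, by simpa using h⟩
    · exact ⟨z, h⟩
  have hle : ∀ w : E, fderiv ℝ f y w = 0 → inner ℝ (x - y) w ≤ 0 := by
    intro w hw
    by_contra! hpos
    have hlim : Tendsto (fun τ : ℝ => inner ℝ (x - y) (w + τ • z)) (𝓝[>] 0)
        (𝓝 (inner ℝ (x - y) w)) := by
      have : Continuous (fun τ : ℝ => inner ℝ (x - y) (w + τ • z)) := by fun_prop
      simpa using (this.tendsto 0).mono_left nhdsWithin_le_nhds
    obtain ⟨τ, h1, hτ⟩ := ((hlim.eventually_const_lt hpos).and self_mem_nhdsWithin).exists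
    have := hhalf _ h1
    rw [map_add, hw, map_smul, zero_add, smul_eq_mul] at this
    exact absurd this (not_le.2 (mul_pos hτ hz))
  have h1 := hle w hw
  have h2 := hle (-w) (by simp [hw])
  rw [inner_neg_right] at h2
  linarith
/-- The Lipschitz cutoff vanishing where the distance to the complement of `Ω` is at most `ε`, equal
to one where it is at least `2 * ε`. -/
noncomputable def innerCutoff {E : Type*} [PseudoMetricSpace E] (Ω : Set E) (ε : ℝ) (x : E) : ℝ :=
  max 0 (min 1 (Metric.infDist x Ωᶜ / ε - 1))

lemma innerCutoff_nonneg {E : Type*} [PseudoMetricSpace E] (Ω : Set E) (ε : ℝ) (x : E) :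
    0 ≤ innerCutoff Ω ε x := le_max_left _ _

lemma innerCutoff_le_one {E : Type*} [PseudoMetricSpace E] (Ω : Set E) (ε : ℝ) (x : E) :
    innerCutoff Ω ε x ≤ 1 := max_le zero_le_one (min_le_left _ _)

lemma innerCutoff_eq_zero {E : Type*} [PseudoMetricSpace E] {Ω : Set E} {ε : ℝ} (hε : 0 < ε) {x : E}
    (hx : Metric.infDist x Ωᶜ ≤ ε) : innerCutoff Ω ε x = 0 := by
  have : Metric.infDist x Ωᶜ / ε ≤ 1 := (div_le_one hε).2 hx
  exact max_eq_left ((min_le_right _ _).trans (by linarith))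

lemma innerCutoff_eq_one {E : Type*} [PseudoMetricSpace E] {Ω : Set E} {ε : ℝ} (hε : 0 < ε) {x : E}
    (hx : 2 * ε ≤ Metric.infDist x Ωᶜ) : innerCutoff Ω ε x = 1 := by
  have : 2 ≤ Metric.infDist x Ωᶜ / ε := (le_div_iff₀ hε).2 hx
  rw [innerCutoff, min_eq_left (by linarith), max_eq_right zero_le_one]

lemma innerCutoff_le_add {E : Type*} [PseudoMetricSpace E] {Ω : Set E} {ε : ℝ} (hε : 0 < ε)
    {x y : E} {r : ℝ} (hr : 0 ≤ r) (h : Metric.infDist x Ωᶜ ≤ Metric.infDist y Ωᶜ + r) :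
    innerCutoff Ω ε x ≤ innerCutoff Ω ε y + r / ε := by
  have h1 : Metric.infDist x Ωᶜ / ε ≤ Metric.infDist y Ωᶜ / ε + r / ε := by
    rw [← add_div]; gcongr
  have h2 : 0 ≤ r / ε := by positivity
  unfold innerCutoff
  simp only [max_def, min_def]
  split_ifs <;> linarith

lemma lipschitzWith_innerCutoff {E : Type*} [PseudoMetricSpace E] (Ω : Set E) {ε : ℝ}
    (hε : 0 < ε) : LipschitzWith (Real.toNNReal ε⁻¹) (innerCutoff Ω ε) := by
  refine LipschitzWith.of_le_add_mul _ fun x y => ?_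
  rw [Real.coe_toNNReal _ (by positivity), inv_mul_eq_div]
  exact innerCutoff_le_add hε dist_nonneg Metric.infDist_le_infDist_add_dist

open Filter Topology Metric in
lemma fderiv_innerCutoff_le {E : Type*} [NormedAddCommGroup E] [InnerProductSpace ℝ E]
    {Ω : Set E} {ε M : ℝ} (hε : 0 < ε) (hM : 0 ≤ M) {x y a b : E} (hy : y ∉ Ω) (hxy : x ≠ y)
    (hd : infDist x Ωᶜ = dist x y) (hdε : infDist x Ωᶜ ≤ 2 * ε)
    (hη : DifferentiableAt ℝ (innerCutoff Ω ε) x) (hb : inner ℝ (x - y) b = 0)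
    (hab : ‖a - b‖ ≤ M * dist x y) :
    fderiv ℝ (innerCutoff Ω ε) x a ≤ 2 * M := by
  have hline : HasDerivAt (fun t : ℝ => innerCutoff Ω ε (x + t • a))
      (fderiv ℝ (innerCutoff Ω ε) x a) 0 := by
    have h0 : HasDerivAt (fun t : ℝ => x + t • a) a 0 := by
      simpa using ((hasDerivAt_id (0 : ℝ)).smul_const a).const_add x
    have h1 : HasFDerivAt (innerCutoff Ω ε) (fderiv ℝ (innerCutoff Ω ε) x) (x + (0 : ℝ) • a) := by
      simpa using hη.hasFDerivAt
    exact h1.comp_hasDerivAt (0 : ℝ) h0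
  have hslope := hline.tendsto_slope_zero_right
  set δ := dist x y with hδ
  have hδ0 : 0 < δ := dist_pos.2 hxy
  have hδn : δ = ‖x - y‖ := dist_eq_norm _ _
  set c := ‖b‖ ^ 2 / (2 * δ) with hc
  have hc0 : 0 ≤ c := by positivity
  have hlim : Tendsto (fun t : ℝ => (t * c + M * δ) / ε) (𝓝[>] 0) (𝓝 (M * δ / ε)) := by
    have : Continuous (fun t : ℝ => (t * c + M * δ) / ε) := by fun_prop
    simpa using (this.tendsto 0).mono_left nhdsWithin_le_nhds
  have hle : fderiv ℝ (innerCutoff Ω ε) x a ≤ M * δ / ε := by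
    refine le_of_tendsto_of_tendsto hslope hlim ?_
    filter_upwards [self_mem_nhdsWithin] with t ht
    have ht : 0 < t := ht
    simp only [zero_add, zero_smul, add_zero, smul_eq_mul]
    have h1 : ‖x - y + t • b‖ ≤ δ + t ^ 2 * c := by
      refine le_of_sq_le_sq ?_ (by positivity)
      rw [norm_add_sq_real, inner_smul_right, hb, norm_smul, mul_pow, Real.norm_eq_abs, sq_abs,
        ← hδn, hc]
      have : (δ + t ^ 2 * (‖b‖ ^ 2 / (2 * δ))) ^ 2
          = δ ^ 2 + t ^ 2 * ‖b‖ ^ 2 + (t ^ 2 * (‖b‖ ^ 2 / (2 * δ))) ^ 2 := by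
        field_simp
        ring
      rw [this]
      nlinarith [sq_nonneg (t ^ 2 * (‖b‖ ^ 2 / (2 * δ)))]
    have h2 : infDist (x + t • a) Ωᶜ ≤ infDist x Ωᶜ + t * (t * c + M * δ) := by
      calc infDist (x + t • a) Ωᶜ ≤ dist (x + t • a) y := infDist_le_dist_of_mem hy
        _ = ‖(x - y + t • b) + t • (a - b)‖ := by
          rw [dist_eq_norm]; congr 1; rw [smul_sub]; abel
        _ ≤ ‖x - y + t • b‖ + ‖t • (a - b)‖ := norm_add_le _ _
        _ ≤ (δ + t ^ 2 * c) + t * (M * δ) := by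
          rw [norm_smul, Real.norm_of_nonneg ht.le]
          gcongr
        _ = _ := by rw [hd]; ring
    have h3 := innerCutoff_le_add hε (by positivity) h2
    rw [inv_mul_le_iff₀ ht]
    calc _ ≤ t * (t * c + M * δ) / ε := by linarith
      _ = _ := by ring
  refine hle.trans ?_
  rw [div_le_iff₀ hε]
  rw [hd] at hdε
  nlinarith

open Filter Topology Metric in
lemma norm_sub_le_of_ball_subset {E F : Type*} [NormedAddCommGroup E] [NormedSpace ℝ E]
    [NormedAddCommGroup F] [NormedSpace ℝ F] {Ω : Set E} (hopen : IsOpen Ω) {w : E → F} {M : ℝ}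
    (hM : 0 ≤ M)
    (hc : ContinuousOn w (closure Ω)) (hdiff : DifferentiableOn ℝ w Ω)
    (hb : ∀ x ∈ Ω, ‖fderiv ℝ w x‖ ≤ M) {x y : E} (hxy : x ≠ y) (hball : ball x (dist x y) ⊆ Ω) :
    ‖w x - w y‖ ≤ M * dist x y := by
  have hL : LipschitzOnWith (Real.toNNReal M) w (ball x (dist x y)) := by
    refine (convex_ball x _).lipschitzOnWith_of_nnnorm_fderiv_le
      (fun z hz => hdiff.differentiableAt (hopen.mem_nhds (hball hz))) fun z hz => ?_
    rw [← NNReal.coe_le_coe, Real.coe_toNNReal _ hM]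
    exact hb z (hball hz)
  have h2 := hL.closure (hc.mono (closure_mono hball))
  rw [closure_ball x (dist_pos.2 hxy).ne'] at h2
  have := h2.dist_le_mul x (mem_closedBall_self dist_nonneg) y
    (by rw [mem_closedBall, dist_comm])
  rwa [Real.coe_toNNReal _ hM, dist_eq_norm] at this
open Filter Topology Metric in
open scoped Manifold in
lemma exists_contDiff_cutoff {E : Type*} [NormedAddCommGroup E] [NormedSpace ℝ E]
    [FiniteDimensional ℝ E] {Ω : Set E} (hbdd : Bornology.IsBounded Ω) {ε : ℝ} (hε : 0 < ε) :
    ∃ χ : E → ℝ, ContDiff ℝ 1 χ ∧ HasCompactSupport χ ∧ tsupport χ ⊆ Ω ∧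
      (∀ x, χ x ∈ Icc (0 : ℝ) 1) ∧ ∀ x, ε < infDist x Ωᶜ → χ =ᶠ[𝓝 x] 1 := by
  have hcont : Continuous fun x : E => infDist x Ωᶜ := continuous_infDist_pt _
  have hs : IsClosed {x : E | ε ≤ infDist x Ωᶜ} := isClosed_le continuous_const hcont
  have ht : IsClosed {x : E | ε / 2 ≤ infDist x Ωᶜ} := isClosed_le continuous_const hcont
  have htΩ : {x : E | ε / 2 ≤ infDist x Ωᶜ} ⊆ Ω := by
    intro x hx
    by_contra h
    have h0 : infDist x Ωᶜ = 0 := infDist_zero_of_mem h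
    have : ε / 2 ≤ infDist x Ωᶜ := hx
    linarith
  have hst : {x : E | ε ≤ infDist x Ωᶜ} ⊆ interior {x : E | ε / 2 ≤ infDist x Ωᶜ} := by
    intro x hx
    have hsub : {x : E | ε / 2 < infDist x Ωᶜ} ⊆ {x : E | ε / 2 ≤ infDist x Ωᶜ} :=
      fun z (hz : ε / 2 < infDist z Ωᶜ) => hz.le
    have : ε ≤ infDist x Ωᶜ := hx
    refine interior_maximal hsub (isOpen_lt continuous_const hcont) ?_
    change ε / 2 < infDist x Ωᶜ
    linarith
  obtain ⟨χ, h1, h2, h3⟩ := exists_contMDiffMap_one_nhds_of_subset_interior (n := 1)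
    𝓘(ℝ, E) hs hst
  have hsupp : tsupport χ ⊆ {x : E | ε / 2 ≤ infDist x Ωᶜ} := by
    refine closure_minimal (fun x hx => ?_) ht
    by_contra h
    exact hx (h2 x h)
  refine ⟨χ, χ.contMDiff.contDiff, ?_, hsupp.trans htΩ, h3, fun x hx => ?_⟩
  · exact Metric.isCompact_of_isClosed_isBounded (isClosed_tsupport _)
      (hbdd.subset (hsupp.trans htΩ))
  · exact h1.filter_mono (nhds_le_nhdsSet (show x ∈ {x : E | ε ≤ infDist x Ωᶜ} from hx.le))

open Filter Topology Metric in
lemma integral_cutoff_mul_div {ι : Type*} [Fintype ι] [DecidableEq ι]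
    {η : EuclideanSpace ℝ ι → ℝ} {W : EuclideanSpace ℝ ι → EuclideanSpace ℝ ι} {C : NNReal}
    (hη : LipschitzWith C η) (hW : ContDiff ℝ 1 W) (hWc : HasCompactSupport W) :
    ∫ x, η x * ∑ i, fderiv ℝ W x (EuclideanSpace.single i 1) i = - ∫ x, fderiv ℝ η x (W x) := by
  have hcd : ∀ i, ContDiff ℝ 1 fun x => W x i := fun i => by fun_prop
  have hcs : ∀ i, HasCompactSupport fun x => W x i := fun i =>
    hWc.comp_left (g := fun z : EuclideanSpace ℝ ι => z i) rfl
  have hfd : ∀ i x v, fderiv ℝ (fun x => W x i) x v = fderiv ℝ W x v i := by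
    intro i x v
    have h1 : HasFDerivAt W (fderiv ℝ W x) x := (hW.differentiable one_ne_zero x).hasFDerivAt
    have h2 := (EuclideanSpace.proj (𝕜 := ℝ) i).hasFDerivAt.comp x h1
    have h3 : HasFDerivAt (fun x => W x i)
      ((EuclideanSpace.proj (𝕜 := ℝ) i).comp (fderiv ℝ W x)) x := h2
    rw [h3.fderiv]
    rfl
  have key : ∀ i : ι, ∫ x, lineDeriv ℝ η x (EuclideanSpace.single i 1) * W x i
      = - ∫ x, η x * fderiv ℝ W x (EuclideanSpace.single i 1) i := by
    intro i
    obtain ⟨D, hD⟩ := (hcd i).lipschitzWith_of_hasCompactSupport (hcs i) one_ne_zero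
    rw [hη.integral_lineDeriv_mul_eq hD (hcs i), ← integral_neg]
    refine integral_congr_ae (ae_of_all _ fun x => ?_)
    simp only
    rw [((hcd i).differentiable one_ne_zero x).lineDeriv_eq_fderiv, hfd, map_neg, PiLp.neg_apply]
    ring
  have int1 : ∀ i : ι, Integrable
      fun x => lineDeriv ℝ η x (EuclideanSpace.single i 1) * W x i := fun i =>
    (((hcd i).continuous.integrable_of_hasCompactSupport (hcs i)).mul_of_top_right
      (hη.memLp_lineDeriv _))
  have int2 : ∀ i : ι, Integrable
      fun x => η x * fderiv ℝ W x (EuclideanSpace.single i 1) i := by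
    intro i
    refine Continuous.integrable_of_hasCompactSupport ?_ ?_
    · have := hW.continuous_fderiv one_ne_zero
      have := hη.continuous
      fun_prop
    · refine HasCompactSupport.mul_left ?_
      exact (hWc.fderiv ℝ).comp_left
        (g := fun L : EuclideanSpace ℝ ι →L[ℝ] EuclideanSpace ℝ ι => L (EuclideanSpace.single i 1) i)
        rfl
  have hae : (fun x => fderiv ℝ η x (W x)) =ᵐ[volume]
      fun x => ∑ i, lineDeriv ℝ η x (EuclideanSpace.single i 1) * W x i := by
    filter_upwards [hη.ae_differentiableAt] with x hx
    conv_lhs => rw [← (EuclideanSpace.basisFun ι ℝ).sum_repr (W x)]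
    simp only [map_sum, map_smul, EuclideanSpace.basisFun_repr, EuclideanSpace.basisFun_apply,
      smul_eq_mul]
    refine Finset.sum_congr rfl fun i _ => ?_
    rw [hx.lineDeriv_eq_fderiv, mul_comm]
  rw [integral_congr_ae hae, integral_finsetSum _ fun i _ => int1 i]
  simp_rw [Finset.mul_sum]
  rw [integral_finsetSum _ fun i _ => int2 i, ← Finset.sum_neg_distrib]
  exact Finset.sum_congr rfl fun i _ => by rw [key, neg_neg]

open Filter Topology Metric in
lemma ball_subset_of_infDist_compl_eq {E : Type*} [PseudoMetricSpace E] {Ω : Set E} {x y : E}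
    (h : infDist x Ωᶜ = dist x y) : ball x (dist x y) ⊆ Ω := by
  intro z hz
  by_contra hzΩ
  have := infDist_le_dist_of_mem (x := x) (show z ∈ Ωᶜ from hzΩ)
  rw [mem_ball, dist_comm] at hz
  linarith

lemma norm_divergence_le {ι : Type*} [Fintype ι] [DecidableEq ι]
    {L : EuclideanSpace ℝ ι →L[ℝ] EuclideanSpace ℝ ι} {M : ℝ} (hL : ‖L‖ ≤ M) :
    ‖∑ i, L (EuclideanSpace.single i 1) i‖ ≤ Fintype.card ι * M := by
  refine (norm_sum_le _ _).trans ?_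
  calc ∑ i, ‖L (EuclideanSpace.single i 1) i‖ ≤ ∑ _i : ι, M := by
        refine Finset.sum_le_sum fun i _ => ?_
        refine (PiLp.norm_apply_le _ i).trans ((L.le_opNorm _).trans ?_)
        simpa using hL
    _ = _ := by simp

open Filter Topology Metric in
/-- The divergence theorem for a vector field tangent to the boundary, the tangency being expressed
at boundary points touched by an inner ball. -/
lemma integral_div_eq_zero_of_tangent {ι : Type*} [Fintype ι] [DecidableEq ι]
    {Ω : Set (EuclideanSpace ℝ ι)} (hopen : IsOpen Ω) (hbdd : Bornology.IsBounded Ω)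
    (hΩ : Ωᶜ.Nonempty) {w : EuclideanSpace ℝ ι → EuclideanSpace ℝ ι}
    (hw : ContDiffOn ℝ 1 w (closure Ω))
    (htan : ∀ x ∈ Ω, ∀ y ∈ frontier Ω, ball x (dist x y) ⊆ Ω → inner ℝ (x - y) (w y) = 0) :
    IntegrableOn (fun x => ∑ i, fderiv ℝ w x (EuclideanSpace.single i 1) i) Ω ∧
      ∫ x in Ω, ∑ i, fderiv ℝ w x (EuclideanSpace.single i 1) i = 0 := by
  obtain ⟨M, hM, hb⟩ := exists_norm_fderiv_le_of_contDiffOn_closure hopen hbdd hw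
  have hwΩ : ContDiffOn ℝ 1 w Ω := hw.mono subset_closure
  have hfc : ContinuousOn (fderiv ℝ w) Ω := hwΩ.continuousOn_fderiv_of_isOpen hopen le_rfl
  set D : EuclideanSpace ℝ ι → ℝ := fun x => ∑ i, fderiv ℝ w x (EuclideanSpace.single i 1) i
    with hD
  set N : ℝ := Fintype.card ι * M with hN
  have hN0 : 0 ≤ N := by positivity
  have hDc : ContinuousOn D Ω := by rw [hD]; fun_prop
  have hDb : ∀ x ∈ Ω, ‖D x‖ ≤ N := fun x hx => norm_divergence_le (hb x hx)
  have hvol : volume Ω < ∞ := hbdd.measure_lt_top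
  have hDi : IntegrableOn D Ω := IntegrableOn.of_bound hvol
    (hDc.aestronglyMeasurable hopen.measurableSet) N
    ((ae_restrict_iff' hopen.measurableSet).2 (ae_of_all _ hDb))
  refine ⟨hDi, ?_⟩
  set T : ℝ → Set (EuclideanSpace ℝ ι) := fun ε => Ω ∩ {x | infDist x Ωᶜ ≤ 2 * ε} with hT
  have hTm : ∀ ε, MeasurableSet (T ε) := fun ε => hopen.measurableSet.inter
    (isClosed_le (continuous_infDist_pt _) continuous_const).measurableSet
  have hTfin : ∀ ε, volume (T ε) ≠ ∞ := fun ε =>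
    ((measure_mono inter_subset_left).trans_lt hvol).ne
  have hstep : ∀ ε : ℝ, 0 < ε → ‖∫ x in Ω, D x‖ ≤ (2 * M + N) * volume.real (T ε) := by
    intro ε hε
    obtain ⟨χ, hχ, hχc, hχΩ, hχ01, hχ1⟩ := exists_contDiff_cutoff hbdd hε
    have hηL := lipschitzWith_innerCutoff Ω hε
    set η := innerCutoff Ω ε with hηdef
    have hχ0 : ∀ x ∉ Ω, χ x = 0 := fun x hx => image_eq_zero_of_notMem_tsupport fun h => hx (hχΩ h)
    set W : EuclideanSpace ℝ ι → EuclideanSpace ℝ ι := fun x => χ x • w x with hWdef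
    have hWc : HasCompactSupport W := hχc.smul_right
    have hW : ContDiff ℝ 1 W := by
      rw [contDiff_iff_contDiffAt]
      intro x
      by_cases hx : x ∈ Ω
      · exact hχ.contDiffAt.smul (hwΩ.contDiffAt (hopen.mem_nhds hx))
      · have : χ =ᶠ[𝓝 x] 0 := notMem_tsupport_iff_eventuallyEq.1 fun h => hx (hχΩ h)
        have h0 : W =ᶠ[𝓝 x] fun _ => 0 := by
          filter_upwards [this] with z hz
          simp [hWdef, hz]
        exact contDiffAt_const.congr_of_eventuallyEq h0
    have hmain := integral_cutoff_mul_div hηL hW hWc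
    have hηz : ∀ x ∉ Ω, η x = 0 := fun x hx => innerCutoff_eq_zero hε (by
      rw [infDist_zero_of_mem (show x ∈ Ωᶜ from hx)]; exact hε.le)
    have hleft : ∫ x, η x * ∑ i, fderiv ℝ W x (EuclideanSpace.single i 1) i
        = ∫ x in Ω, η x * D x := by
      rw [← integral_indicator hopen.measurableSet]
      refine integral_congr_ae (ae_of_all _ fun x => ?_)
      simp only
      by_cases hx : x ∈ Ω
      · rw [indicator_of_mem hx]
        by_cases hxε : ε < infDist x Ωᶜ
        · have hev : W =ᶠ[𝓝 x] w := by
            filter_upwards [hχ1 x hxε] with z hz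
            simp [hWdef, hz]
          rw [hev.fderiv_eq]
        · simp [hηdef, innerCutoff_eq_zero hε (not_lt.1 hxε)]
      · rw [indicator_of_notMem hx, hηz x hx, zero_mul]
    have hright : ‖∫ x, fderiv ℝ η x (W x)‖ ≤ 2 * M * volume.real (T ε) := by
      have hbound : ∀ᵐ x, ‖fderiv ℝ η x (W x)‖ ≤ (T ε).indicator (fun _ => 2 * M) x := by
        filter_upwards [hηL.ae_differentiableAt] with x hx
        by_cases hxΩ : x ∈ Ω
        swap
        · rw [indicator_of_notMem fun h => hxΩ h.1]
          simp [hWdef, hχ0 x hxΩ]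
        by_cases hxT : infDist x Ωᶜ ≤ 2 * ε
        · rw [indicator_of_mem (show x ∈ T ε from ⟨hxΩ, hxT⟩)]
          obtain ⟨y, hy, hxy⟩ := exists_mem_frontier_infDist_compl_eq_dist hxΩ
            (nonempty_compl.1 hΩ)
          have hyΩ : y ∉ Ω := fun h => by
            rw [hopen.frontier_eq] at hy
            exact hy.2 h
          have hne : x ≠ y := fun h => hyΩ (h ▸ hxΩ)
          have hball := ball_subset_of_infDist_compl_eq hxy
          have hperp := htan x hxΩ y hy hball
          have hsub := norm_sub_le_of_ball_subset hopen hM hw.continuousOn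
            (hwΩ.differentiableOn one_ne_zero) hb hne hball
          have h1 := fderiv_innerCutoff_le hε hM hyΩ hne hxy hxT hx hperp hsub
          have h2 := fderiv_innerCutoff_le (a := -w x) (b := -w y) hε hM hyΩ hne hxy hxT hx
            (by rw [inner_neg_right, hperp, neg_zero])
            (by rwa [neg_sub_neg, norm_sub_rev])
          rw [map_neg] at h2
          rw [hWdef, map_smul, norm_smul, Real.norm_of_nonneg (hχ01 x).1]
          have h3 : ‖fderiv ℝ η x (w x)‖ ≤ 2 * M := by
            rw [Real.norm_eq_abs, abs_le]
            constructor <;> linarith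
          calc χ x * ‖fderiv ℝ η x (w x)‖ ≤ 1 * (2 * M) := by
                gcongr
                exact (hχ01 x).2
            _ = _ := one_mul _
        · rw [indicator_of_notMem fun h => hxT h.2]
          have hev : η =ᶠ[𝓝 x] fun _ => 1 := by
            filter_upwards [(isOpen_lt continuous_const (continuous_infDist_pt Ωᶜ)).mem_nhds
              (show 2 * ε < infDist x Ωᶜ from not_le.1 hxT)] with z hz
            exact innerCutoff_eq_one hε (le_of_lt hz)
          rw [hev.fderiv_eq]
          simp
      refine (norm_integral_le_of_norm_le
        ((integrable_indicator_iff (hTm ε)).2 (integrableOn_const (hTfin ε))) hbound).trans ?_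
      rw [integral_indicator (hTm ε), setIntegral_const, smul_eq_mul, mul_comm]
    have hrest : ‖∫ x in Ω, (1 - η x) * D x‖ ≤ N * volume.real (T ε) := by
      have hbound : ∀ᵐ x ∂(volume.restrict Ω), ‖(1 - η x) * D x‖
          ≤ (T ε).indicator (fun _ => N) x := by
        refine (ae_restrict_iff' hopen.measurableSet).2 (ae_of_all _ fun x hx => ?_)
        by_cases hxT : infDist x Ωᶜ ≤ 2 * ε
        · rw [indicator_of_mem (show x ∈ T ε from ⟨hx, hxT⟩), norm_mul]
          have h1 := innerCutoff_nonneg Ω ε x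
          have h2 := innerCutoff_le_one Ω ε x
          calc ‖1 - η x‖ * ‖D x‖ ≤ 1 * N := by
                gcongr
                · rw [Real.norm_eq_abs, abs_le]
                  constructor <;> linarith
                · exact hDb x hx
            _ = N := one_mul _
        · rw [indicator_of_notMem fun h => hxT h.2, hηdef,
            innerCutoff_eq_one hε (not_le.1 hxT).le]
          simp
      refine (norm_integral_le_of_norm_le
        (((integrable_indicator_iff (hTm ε)).2 (integrableOn_const (hTfin ε))).mono_measure
          Measure.restrict_le_self) hbound).trans ?_
      rw [integral_indicator (hTm ε), Measure.restrict_restrict (hTm ε),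
        inter_eq_left.2 (inter_subset_left : T ε ⊆ Ω), setIntegral_const, smul_eq_mul, mul_comm]
    have hηD : IntegrableOn (fun x => η x * D x) Ω := by
      refine IntegrableOn.of_bound hvol
        ((hηL.continuous.continuousOn.mul hDc).aestronglyMeasurable hopen.measurableSet) N
        ((ae_restrict_iff' hopen.measurableSet).2 (ae_of_all _ fun x hx => ?_))
      have h1 := innerCutoff_nonneg Ω ε x
      have h2 := innerCutoff_le_one Ω ε x
      rw [norm_mul, Real.norm_of_nonneg h1]
      calc η x * ‖D x‖ ≤ 1 * N := by
            gcongr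
            exact hDb x hx
        _ = N := one_mul _
    have hsplit : ∫ x in Ω, D x = (∫ x in Ω, η x * D x) + ∫ x in Ω, (1 - η x) * D x := by
      have hint : IntegrableOn (fun x => (1 - η x) * D x) Ω :=
        (hDi.sub hηD).congr (ae_of_all _ fun x => by simp only [Pi.sub_apply]; ring)
      rw [← integral_add hηD hint]
      exact integral_congr_ae (ae_of_all _ fun x => by simp only; ring)
    rw [hsplit, ← hleft, hmain]
    calc _ ≤ ‖-∫ x, fderiv ℝ η x (W x)‖ + ‖∫ x in Ω, (1 - η x) * D x‖ := norm_add_le _ _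
      _ ≤ 2 * M * volume.real (T ε) + N * volume.real (T ε) := by
        rw [norm_neg]; exact add_le_add hright hrest
      _ = _ := by ring
  have hlimT : Tendsto (fun n : ℕ => volume.real (T (1 / (n + 1 : ℝ)))) atTop (𝓝 0) := by
    have hempty : ⋂ n : ℕ, T (1 / (n + 1 : ℝ)) = ∅ := by
      rw [eq_empty_iff_forall_notMem]
      intro x hx
      rw [mem_iInter] at hx
      have hle : ∀ n : ℕ, infDist x Ωᶜ ≤ 2 * (1 / (n + 1 : ℝ)) := fun n => (hx n).2
      have h0 : infDist x Ωᶜ ≤ 0 := by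
        refine ge_of_tendsto' (x := atTop) ?_ hle
        simpa using (tendsto_one_div_add_atTop_nhds_zero_nat (𝕜 := ℝ)).const_mul 2
      have hmem : x ∈ closure Ωᶜ := (mem_closure_iff_infDist_zero hΩ).2
        (le_antisymm h0 infDist_nonneg)
      rw [hopen.isClosed_compl.closure_eq] at hmem
      exact hmem (hx 0).1
    have hanti : Antitone fun n : ℕ => T (1 / (n + 1 : ℝ)) := by
      intro m n hmn x hx
      have h1 : (1 : ℝ) / (n + 1) ≤ 1 / (m + 1) := Nat.one_div_le_one_div hmn
      have h2 : infDist x Ωᶜ ≤ 2 * (1 / (n + 1 : ℝ)) := hx.2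
      exact ⟨hx.1, show infDist x Ωᶜ ≤ 2 * (1 / (m + 1 : ℝ)) by linarith⟩
    have := tendsto_measure_iInter_atTop (μ := volume)
      (fun n : ℕ => (hTm (1 / (n + 1 : ℝ))).nullMeasurableSet) hanti ⟨0, hTfin _⟩
    rw [hempty, measure_empty] at this
    simpa [measureReal_def, Function.comp_def] using (ENNReal.tendsto_toReal ENNReal.zero_ne_top).comp this
  have hfinal : ‖∫ x in Ω, D x‖ ≤ 0 := by
    refine ge_of_tendsto' (x := atTop) (f := fun n : ℕ =>
      (2 * M + N) * volume.real (T (1 / (n + 1 : ℝ)))) ?_ fun n => hstep _ (by positivity)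
    simpa using hlimT.const_mul (2 * M + N)
  exact norm_le_zero_iff.1 hfinal
/-- One-dimensional trace inequality. -/
lemma ofReal_le_lintegral_of_hasDerivAt {φ φ' : ℝ → ℝ} {h B : ℝ} (hh : 0 < h)
    (hφ : ContinuousOn φ (Icc 0 h)) (hd : ∀ t ∈ Ioo 0 h, HasDerivAt φ (φ' t) t)
    (hφ' : ContinuousOn φ' (Ioo 0 h)) (hB : ∀ t ∈ Ioo 0 h, |φ' t| ≤ B) :
    ENNReal.ofReal (φ 0) ≤ ∫⁻ t in Ioo 0 h, ENNReal.ofReal (|φ t| / h + |φ' t|) := by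
  have hcIoo : ContinuousOn φ (Ioo 0 h) := hφ.mono Ioo_subset_Icc_self
  have hfin : volume (Ioo 0 h) < ∞ := by simp
  have hintφ : IntegrableOn φ (Ioo 0 h) := hφ.integrableOn_Icc.mono_set Ioo_subset_Icc_self
  have hintφ' : IntegrableOn φ' (Ioo 0 h) :=
    IntegrableOn.of_bound hfin (hφ'.aestronglyMeasurable measurableSet_Ioo) B
      ((ae_restrict_iff' measurableSet_Ioo).2 (ae_of_all _ hB))
  have hint1 : IntegrableOn (fun t => |φ t| / h + |φ' t|) (Ioo 0 h) :=
    (hintφ.abs.div_const h).add hintφ'.abs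
  set ψ' : ℝ → ℝ := fun t => -(1 / h) * φ t + (1 - t / h) * φ' t with hψ'
  have hbound : ∀ t ∈ Ioo 0 h, |ψ' t| ≤ |φ t| / h + |φ' t| := by
    intro t ht
    have h1 : 0 ≤ 1 - t / h := by
      have := (div_le_one hh).2 ht.2.le
      linarith
    have h2 : 1 - t / h ≤ 1 := by
      have := div_nonneg ht.1.le hh.le
      linarith
    calc |ψ' t| ≤ |-(1 / h) * φ t| + |(1 - t / h) * φ' t| := abs_add_le _ _
      _ = |φ t| / h + (1 - t / h) * |φ' t| := by
        rw [abs_mul, abs_mul, abs_of_nonneg h1, abs_neg, abs_of_pos (by positivity : 0 < 1 / h)]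
        ring
      _ ≤ |φ t| / h + 1 * |φ' t| := by gcongr
      _ = _ := by ring
  have hψ'c : ContinuousOn ψ' (Ioo 0 h) := by
    rw [hψ']; fun_prop
  have hψ'i : IntegrableOn ψ' (Ioo 0 h) :=
    hint1.mono' (hψ'c.aestronglyMeasurable measurableSet_Ioo)
      ((ae_restrict_iff' measurableSet_Ioo).2 (ae_of_all _ hbound))
  have hftc : ∫ t in (0 : ℝ)..h, ψ' t = (1 - h / h) * φ h - (1 - 0 / h) * φ 0 := by
    refine intervalIntegral.integral_eq_sub_of_hasDerivAt_of_le
      (f := fun t => (1 - t / h) * φ t) hh.le (by fun_prop) (fun t ht => ?_) ?_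
    · have h1 : HasDerivAt (fun t : ℝ => 1 - t / h) (-(1 / h)) t := by
        simpa using ((hasDerivAt_id t).div_const h).const_sub 1
      exact h1.mul (hd t ht)
    · rwa [intervalIntegrable_iff_integrableOn_Ioo_of_le hh.le]
  rw [div_self hh.ne', intervalIntegral.integral_of_le hh.le, integral_Ioc_eq_integral_Ioo] at hftc
  have hle : φ 0 ≤ ∫ t in Ioo 0 h, (|φ t| / h + |φ' t|) := by
    have h1 : φ 0 = ∫ t in Ioo 0 h, -ψ' t := by
      rw [integral_neg, hftc]; ring
    rw [h1]
    exact setIntegral_mono_on hψ'i.neg hint1 measurableSet_Ioo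
      fun t ht => (neg_le_abs _).trans (hbound t ht)
  rw [← ofReal_integral_eq_lintegral_ofReal hint1 (ae_of_all _ fun t => by positivity)]
  exact ENNReal.ofReal_le_ofReal hle

/-- Dropping the `i`-th coordinate. -/
def dropCoord {n : ℕ} (i : Fin (n + 1)) (x : EuclideanSpace ℝ (Fin (n + 1))) : Fin n → ℝ :=
  fun j => x (i.succAbove j)

lemma dropCoord_sub {n : ℕ} (i : Fin (n + 1)) (x y : EuclideanSpace ℝ (Fin (n + 1))) :
    dropCoord i (x - y) = dropCoord i x - dropCoord i y := rfl

@[fun_prop]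
lemma continuous_dropCoord {n : ℕ} (i : Fin (n + 1)) : Continuous (dropCoord (n := n) i) := by
  unfold dropCoord
  fun_prop

open WithLp in
lemma lintegral_eq_lintegral_insertNth {n : ℕ} (i : Fin (n + 1))
    {F : EuclideanSpace ℝ (Fin (n + 1)) → ℝ≥0∞} (hF : Measurable F) :
    ∫⁻ x, F x = ∫⁻ p : Fin n → ℝ, ∫⁻ τ : ℝ, F (toLp 2 (i.insertNth τ p)) := by
  have h1 : MeasurePreserving
      (MeasurableEquiv.piFinSuccAbove (fun _ : Fin (n + 1) => ℝ) i).symm :=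
    (volume_preserving_piFinSuccAbove (fun _ : Fin (n + 1) => ℝ) i).symm _
  have hm : Measurable (toLp 2 : (Fin (n + 1) → ℝ) → EuclideanSpace ℝ (Fin (n + 1))) :=
    (PiLp.volume_preserving_toLp (Fin (n + 1))).measurable
  rw [← (PiLp.volume_preserving_toLp (Fin (n + 1))).lintegral_comp hF,
    ← h1.lintegral_comp (f := fun a => F (toLp 2 a)) (hF.comp hm), Measure.volume_eq_prod,
    lintegral_prod_symm' (fun a => F (toLp 2 ((MeasurableEquiv.piFinSuccAbove
      (fun _ : Fin (n + 1) => ℝ) i).symm a))) ((hF.comp hm).comp h1.measurable)]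
  rfl

open WithLp in
lemma lintegral_add_smul_single {n : ℕ} (i : Fin (n + 1))
    (F : EuclideanSpace ℝ (Fin (n + 1)) → ℝ≥0∞) (y : EuclideanSpace ℝ (Fin (n + 1))) :
    ∫⁻ t : ℝ, F (y + t • EuclideanSpace.single i 1)
      = ∫⁻ τ : ℝ, F (toLp 2 (i.insertNth τ (dropCoord i y))) := by
  rw [← lintegral_add_left_eq_self
    (fun τ : ℝ => F (toLp 2 (i.insertNth τ (dropCoord i y)))) (y i)]
  refine lintegral_congr fun t => ?_
  congr 1
  ext j
  refine i.succAboveCases ?_ (fun k => ?_) j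
  · simp
  · simp [dropCoord, Fin.succAbove_ne]

lemma hausdorffMeasure_le_of_antilipschitzOn {X Y : Type*} [MetricSpace X] [MeasurableSpace X]
    [BorelSpace X] [MetricSpace Y] [MeasurableSpace Y] [BorelSpace Y] {g : X → Y} {S : Set X}
    {K : NNReal} (hg : ∀ x ∈ S, ∀ y ∈ S, dist x y ≤ K * dist (g x) (g y)) {d : ℝ} (hd : 0 ≤ d) :
    μH[d] S ≤ (K : ℝ≥0∞) ^ d * μH[d] (g '' S) := by
  rcases S.eq_empty_or_nonempty with rfl | ⟨x₀, hx₀⟩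
  · simp
  have : Nonempty X := ⟨x₀⟩
  have hinj : InjOn g S := fun x hx y hy hxy => by
    have := hg x hx y hy
    rw [hxy, dist_self, mul_zero] at this
    exact dist_le_zero.1 this
  have hL : LipschitzOnWith K (Function.invFunOn g S) (g '' S) := by
    refine LipschitzOnWith.of_dist_le_mul ?_
    rintro _ ⟨x, hx, rfl⟩ _ ⟨y, hy, rfl⟩
    rw [hinj.leftInvOn_invFunOn hx, hinj.leftInvOn_invFunOn hy]
    exact hg x hx y hy
  have := hL.hausdorffMeasure_image_le hd
  rwa [hinj.leftInvOn_invFunOn.image_image] at this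

/-- If dropping a coordinate is antilipschitz on `S`, then integrals over `S` of functions dominated
by line integrals along that coordinate are controlled by volume integrals. -/
lemma lintegral_hausdorffMeasure_le {n : ℕ} {i : Fin (n + 1)}
    {S : Set (EuclideanSpace ℝ (Fin (n + 1)))} (hS : MeasurableSet S) {K : NNReal}
    (hK : ∀ x ∈ S, ∀ y ∈ S, dist x y ≤ K * dist (dropCoord i x) (dropCoord i y))
    {F G : EuclideanSpace ℝ (Fin (n + 1)) → ℝ≥0∞} (hF : Measurable F)
    (hG : ∀ y ∈ S, G y ≤ ∫⁻ t : ℝ, F (y + t • EuclideanSpace.single i 1)) :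
    ∫⁻ y in S, G y ∂μH[(n : ℝ)] ≤ (K : ℝ≥0∞) ^ (n : ℝ) * ∫⁻ x, F x := by
  set H : (Fin n → ℝ) → ℝ≥0∞ := fun p => ∫⁻ τ : ℝ, F (WithLp.toLp 2 (i.insertNth τ p)) with hH
  have hHm : Measurable H := by
    refine Measurable.lintegral_prod_left'
      (f := fun τp : ℝ × (Fin n → ℝ) => F (WithLp.toLp 2 (i.insertNth τp.1 τp.2))) ?_
    exact hF.comp ((PiLp.volume_preserving_toLp (Fin (n + 1))).measurable.comp
      (MeasurableEquiv.piFinSuccAbove (fun _ : Fin (n + 1) => ℝ) i).symm.measurable)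
  have hgm : Measurable (dropCoord (n := n) i) := (continuous_dropCoord i).measurable
  have hmeas : ((μH[(n : ℝ)]).restrict S).map (dropCoord i)
      ≤ ((K : ℝ≥0∞) ^ (n : ℝ)) • (volume : Measure (Fin n → ℝ)) := by
    refine Measure.le_iff.2 fun A hA => ?_
    rw [Measure.map_apply hgm hA, Measure.restrict_apply (hgm hA), Measure.smul_apply, smul_eq_mul]
    refine (hausdorffMeasure_le_of_antilipschitzOn (g := dropCoord i) (K := K)
      (fun x hx y hy => hK x hx.2 y hy.2) n.cast_nonneg).trans ?_
    have : (μH[(n : ℝ)] : Measure (Fin n → ℝ)) = volume := by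
      simpa using hausdorffMeasure_pi_real (ι := Fin n)
    rw [this]
    gcongr
    rintro _ ⟨x, hx, rfl⟩
    exact hx.1
  calc ∫⁻ y in S, G y ∂μH[(n : ℝ)] ≤ ∫⁻ y in S, H (dropCoord i y) ∂μH[(n : ℝ)] := by
        refine setLIntegral_mono' hS fun y hy => (hG y hy).trans_eq ?_
        exact lintegral_add_smul_single i F y
    _ = ∫⁻ p, H p ∂(((μH[(n : ℝ)]).restrict S).map (dropCoord i)) :=
        (lintegral_map hHm hgm).symm
    _ ≤ ∫⁻ p, H p ∂(((K : ℝ≥0∞) ^ (n : ℝ)) • (volume : Measure (Fin n → ℝ))) :=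
        lintegral_mono' hmeas le_rfl
    _ = (K : ℝ≥0∞) ^ (n : ℝ) * ∫⁻ p, H p := by rw [lintegral_smul_measure, smul_eq_mul]
    _ = _ := by rw [lintegral_eq_lintegral_insertNth i hF]
lemma eq_add_sum_dropCoord {n : ℕ} (i : Fin (n + 1)) (z : EuclideanSpace ℝ (Fin (n + 1))) :
    z = z i • EuclideanSpace.single i (1 : ℝ)
      + ∑ j, dropCoord i z j • EuclideanSpace.single (i.succAbove j) (1 : ℝ) := by
  conv_lhs => rw [← (EuclideanSpace.basisFun (Fin (n + 1)) ℝ).sum_repr z, Fin.sum_univ_succAbove _ i]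
  simp [dropCoord]

lemma norm_sum_dropCoord_le {n : ℕ} (i : Fin (n + 1)) (z : EuclideanSpace ℝ (Fin (n + 1))) :
    ‖∑ j, dropCoord i z j • EuclideanSpace.single (i.succAbove j) (1 : ℝ)‖
      ≤ n * ‖dropCoord i z‖ := by
  refine (norm_sum_le _ _).trans ?_
  calc _ ≤ ∑ _j : Fin n, ‖dropCoord i z‖ := Finset.sum_le_sum fun j _ => by
        simpa [norm_smul] using norm_le_pi_norm (dropCoord i z) j
    _ = _ := by simp

open Filter Topology in
lemma eq_zero_of_mem_frontier {E : Type*} [TopologicalSpace E] {Ω : Set E} (hopen : IsOpen Ω)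
    {f : E → ℝ} {y : E} (hy : y ∈ frontier Ω) (hf : ContinuousAt f y)
    (hΩ : ∀ᶠ z in 𝓝 y, (z ∈ Ω ↔ f z < 0)) : f y = 0 := by
  rw [hopen.frontier_eq] at hy
  refine le_antisymm ?_ (not_lt.1 fun h => hy.2 (hΩ.self_of_nhds.2 h))
  by_contra! hpos
  obtain ⟨z, hzΩ, h1, h2⟩ := ((mem_closure_iff_frequently.1 hy.1).and_eventually
    (hΩ.and (hf.eventually_const_lt hpos))).exists
  exact absurd (h1.1 hzΩ) h2.le.not_gt

open Filter Topology Metric in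
/-- Near a boundary point, the boundary is a Lipschitz graph over a coordinate hyperplane, and the
domain contains the short segments going inwards in the corresponding coordinate direction. -/
lemma exists_local_graph {n : ℕ} {Ω : Set (EuclideanSpace ℝ (Fin (n + 1)))} (hopen : IsOpen Ω)
    {x₀ : EuclideanSpace ℝ (Fin (n + 1))} {f : EuclideanSpace ℝ (Fin (n + 1)) → ℝ}
    (hf : ContDiffAt ℝ 1 f x₀) (hne : fderiv ℝ f x₀ ≠ 0)
    (hΩ : ∀ᶠ y in 𝓝 x₀, (y ∈ Ω ↔ f y < 0)) :
    ∃ r : ℝ, 0 < r ∧ ∃ h : ℝ, 0 < h ∧ ∃ K : NNReal, ∃ i : Fin (n + 1), ∃ σ : ℝ, (σ = 1 ∨ σ = -1) ∧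
      (∀ x ∈ frontier Ω ∩ closedBall x₀ r, ∀ y ∈ frontier Ω ∩ closedBall x₀ r,
        dist x y ≤ K * dist (dropCoord i x) (dropCoord i y)) ∧
      ∀ y ∈ frontier Ω ∩ closedBall x₀ r, ∀ t ∈ Ioo 0 h,
        y + t • (σ • EuclideanSpace.single i (1 : ℝ)) ∈ Ω := by
  set L := fderiv ℝ f x₀ with hL
  obtain ⟨i, hi⟩ : ∃ i, L (EuclideanSpace.single i 1) ≠ 0 := by
    by_contra! h
    refine hne (ContinuousLinearMap.ext fun z => ?_)
    rw [← (EuclideanSpace.basisFun (Fin (n + 1)) ℝ).sum_repr z]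
    simp [h]
  set e := EuclideanSpace.single i (1 : ℝ) with he
  set c := |L e| / 4 with hc
  have hc0 : 0 < c := by positivity
  have hLe : |L e| = 4 * c := by rw [hc]; ring
  have hstrict := (hf.hasStrictFDerivAt one_ne_zero).isLittleO.def hc0
  rw [nhds_prod_eq, eventually_prod_self_iff'] at hstrict
  obtain ⟨t, ht, hts⟩ := hstrict
  have hzero : ∀ᶠ y in 𝓝 x₀, y ∈ frontier Ω → f y = 0 := by
    filter_upwards [hf.eventually (by simp), hΩ.eventually_nhds] with y h1 h2 hy
    exact eq_zero_of_mem_frontier hopen hy h1.continuousAt h2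
  obtain ⟨δ, hδ, hball⟩ := Metric.eventually_nhds_iff_ball.1 ((hzero.and hΩ).and ht)
  obtain ⟨σ, hσ, hσL⟩ : ∃ σ : ℝ, (σ = 1 ∨ σ = -1) ∧ σ * L e = -(4 * c) := by
    rcases lt_or_gt_of_ne hi with h | h
    · exact ⟨1, Or.inl rfl, by rw [← hLe, abs_of_neg h]; ring⟩
    · exact ⟨-1, Or.inr rfl, by rw [← hLe, abs_of_pos h]; ring⟩
  have hσe : ‖σ • e‖ = 1 := by
    rcases hσ with rfl | rfl <;> simp [he]
  have hsub : closedBall x₀ (δ / 2) ⊆ ball x₀ δ := closedBall_subset_ball (by linarith)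
  set K : ℝ := (‖L‖ + 4 * c) * n / (3 * c) with hK
  have hK0 : 0 ≤ K := by positivity
  refine ⟨δ / 2, by positivity, δ / 2, by positivity, ⟨K, hK0⟩, i, σ, hσ, ?_, ?_⟩
  · rintro x ⟨hxf, hx⟩ y ⟨hyf, hy⟩
    have hx' := hball x (hsub hx)
    have hy' := hball y (hsub hy)
    have hs := hts x hx'.2 y hy'.2
    simp only [hx'.1.1 hxf, hy'.1.1 hyf, sub_zero, zero_sub, norm_neg] at hs
    rw [dist_eq_norm, dist_eq_norm, ← dropCoord_sub]
    set z := x - y with hz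
    have hdec := eq_add_sum_dropCoord i z
    have hq := norm_sum_dropCoord_le i z
    set q := ∑ j, dropCoord i z j • EuclideanSpace.single (i.succAbove j) (1 : ℝ) with hq'
    have hLz : L z = z i * L e + L q := by
      conv_lhs => rw [hdec]
      simp [he]
    have h1 : |z i| * (4 * c) ≤ c * ‖z‖ + ‖L‖ * ‖q‖ := by
      rw [← hLe, ← abs_mul]
      have : z i * L e = L z - L q := by rw [hLz]; ring
      rw [this]
      calc |L z - L q| ≤ |L z| + |L q| := abs_sub _ _
        _ ≤ c * ‖z‖ + ‖L‖ * ‖q‖ := add_le_add hs (L.le_opNorm q)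
    have h2 : ‖z‖ ≤ |z i| + ‖q‖ := by
      conv_lhs => rw [hdec]
      refine (norm_add_le _ _).trans_eq ?_
      simp [norm_smul]
    have h3 : 3 * c * ‖z‖ ≤ (‖L‖ + 4 * c) * ‖q‖ := by nlinarith
    have h4 : 3 * c * ‖z‖ ≤ (‖L‖ + 4 * c) * (n * ‖dropCoord i z‖) :=
      h3.trans (by gcongr)
    change ‖z‖ ≤ K * ‖dropCoord i z‖
    rw [hK, div_mul_eq_mul_div, le_div_iff₀ (by positivity)]
    linarith
  · rintro y ⟨hyf, hy⟩ τ ⟨hτ0, hτ⟩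
    have hy' := hball y (hsub hy)
    have hmem : y + τ • (σ • e) ∈ ball x₀ δ := by
      rw [mem_ball, dist_eq_norm]
      rw [mem_closedBall, dist_eq_norm] at hy
      calc ‖y + τ • (σ • e) - x₀‖ = ‖(y - x₀) + τ • (σ • e)‖ := by congr 1; abel
        _ ≤ ‖y - x₀‖ + ‖τ • (σ • e)‖ := norm_add_le _ _
        _ = ‖y - x₀‖ + τ := by rw [norm_smul, hσe, Real.norm_of_nonneg hτ0.le, mul_one]
        _ < δ := by linarith
    have hz' := hball _ hmem
    rw [hz'.1.2]
    have hs := hts _ hz'.2 y hy'.2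
    simp only [hy'.1.1 hyf, sub_zero, add_sub_cancel_left] at hs
    rw [norm_smul τ, hσe, Real.norm_of_nonneg hτ0.le, mul_one, map_smul, map_smul, smul_eq_mul,
      smul_eq_mul, hσL, Real.norm_eq_abs, abs_le] at hs
    nlinarith [hs.2, mul_pos hτ0 hc0]
lemma measurable_indicator_of_continuousOn {X : Type*} [TopologicalSpace X] [MeasurableSpace X]
    [OpensMeasurableSpace X] {Ω : Set X} (hΩ : MeasurableSet Ω) {F : X → ℝ≥0∞}
    (hF : ContinuousOn F Ω) : Measurable (Ω.indicator F) := by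
  classical
  rw [← piecewise_eq_indicator]
  exact hF.measurable_piecewise continuousOn_const hΩ

lemma lintegral_smul_sign {σ : ℝ} (hσ : σ = 1 ∨ σ = -1) (F : ℝ → ℝ≥0∞) :
    ∫⁻ t : ℝ, F (t * σ) = ∫⁻ t : ℝ, F t := by
  rcases hσ with rfl | rfl
  · simp
  · simpa using lintegral_neg_eq_self (μ := (volume : Measure ℝ)) F

/-- The integrand controlling the boundary trace. -/
noncomputable def traceDensity {E V : Type*} [NormedAddCommGroup E] [NormedSpace ℝ E]
    [NormedAddCommGroup V] [NormedSpace ℝ V] (v : E → V) (x : E) : ℝ :=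
  ‖v x‖ ^ 2 + ‖v x‖ * ‖fderiv ℝ v x‖

open Metric in
lemma exists_local_trace_le {n : ℕ} {V : Type*} [NormedAddCommGroup V] [InnerProductSpace ℝ V]
    {Ω : Set (EuclideanSpace ℝ (Fin (n + 1)))} (hopen : IsOpen Ω) (hbdd : Bornology.IsBounded Ω)
    {x₀ : EuclideanSpace ℝ (Fin (n + 1))} {f : EuclideanSpace ℝ (Fin (n + 1)) → ℝ}
    (hf : ContDiffAt ℝ 1 f x₀) (hne : fderiv ℝ f x₀ ≠ 0)
    (hΩ : ∀ᶠ y in nhds x₀, (y ∈ Ω ↔ f y < 0)) :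
    ∃ r : ℝ, 0 < r ∧ ∃ C : NNReal, ∀ v : EuclideanSpace ℝ (Fin (n + 1)) → V,
      ContDiffOn ℝ 1 v (closure Ω) →
      ∫⁻ y in frontier Ω ∩ closedBall x₀ r, ENNReal.ofReal (‖v y‖ ^ 2) ∂μH[(n : ℝ)]
        ≤ C * ∫⁻ x in Ω, ENNReal.ofReal (traceDensity v x) := by
  obtain ⟨r, hr, h, hh, K, i, σ, hσ, hK, hseg⟩ := exists_local_graph hopen hf hne hΩ
  set e : EuclideanSpace ℝ (Fin (n + 1)) := σ • EuclideanSpace.single i (1 : ℝ) with he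
  have hen : ‖e‖ = 1 := by rcases hσ with rfl | rfl <;> simp [he]
  set c : ℝ := max (1 / h) 2 with hc
  have hc0 : 0 < c := lt_max_of_lt_right two_pos
  refine ⟨r, hr, K ^ (n : ℝ) * Real.toNNReal c, fun v hv => ?_⟩
  have hvΩ : ContDiffOn ℝ 1 v Ω := hv.mono subset_closure
  have hvc : ContinuousOn v Ω := hvΩ.continuousOn
  have hfc : ContinuousOn (fderiv ℝ v) Ω := hvΩ.continuousOn_fderiv_of_isOpen hopen le_rfl
  obtain ⟨M, hM, hMb⟩ := exists_norm_fderiv_le_of_contDiffOn_closure hopen hbdd hv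
  obtain ⟨A, hA⟩ := hbdd.isCompact_closure.exists_bound_of_continuousOn hv.continuousOn
  set F : EuclideanSpace ℝ (Fin (n + 1)) → ℝ≥0∞ :=
    Ω.indicator fun x => ENNReal.ofReal (c * traceDensity v x) with hF
  have hFm : Measurable F := by
    refine measurable_indicator_of_continuousOn hopen.measurableSet ?_
    unfold traceDensity
    refine ENNReal.continuous_ofReal.comp_continuousOn ?_
    fun_prop
  have hFline : ∀ y ∈ frontier Ω ∩ closedBall x₀ r, ENNReal.ofReal (‖v y‖ ^ 2)
      ≤ ∫⁻ t : ℝ, F (y + t • EuclideanSpace.single i (1 : ℝ)) := by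
    intro y hy
    have hcl : ∀ t ∈ Icc 0 h, y + t • e ∈ closure Ω := by
      have hcont : Continuous fun t : ℝ => y + t • e := by fun_prop
      have := (show MapsTo (fun t : ℝ => y + t • e) (Ioo 0 h) Ω from hseg y hy).closure hcont
      rwa [closure_Ioo hh.ne] at this
    set φ' : ℝ → ℝ := fun t => 2 * inner ℝ (v (y + t • e)) (fderiv ℝ v (y + t • e) e) with hφ'
    have hφ'b : ∀ t ∈ Ioo 0 h, |φ' t| ≤ 2 * (‖v (y + t • e)‖ * ‖fderiv ℝ v (y + t • e)‖) := by
      intro t ht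
      rw [hφ', abs_mul, abs_of_pos (two_pos : (0 : ℝ) < 2)]
      gcongr
      refine (abs_real_inner_le_norm _ _).trans ?_
      gcongr
      exact ((fderiv ℝ v (y + t • e)).le_opNorm e).trans_eq (by rw [hen, mul_one])
    have hmaps : MapsTo (fun t : ℝ => y + t • e) (Ioo 0 h) Ω := hseg y hy
    have hline : ContinuousOn (fun t : ℝ => y + t • e) (Ioo 0 h) := by fun_prop
    have h1 := ofReal_le_lintegral_of_hasDerivAt (φ := fun t => ‖v (y + t • e)‖ ^ 2) (φ' := φ')
      (B := 2 * (A * M)) hh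
      ((hv.continuousOn.comp (f := fun t : ℝ => y + t • e) (by fun_prop) hcl).norm.pow 2)
      (fun t ht => by
        have hline : HasDerivAt (fun t : ℝ => y + t • e) e t := by
          simpa using ((hasDerivAt_id t).smul_const e).const_add y
        have hvd : HasFDerivAt v (fderiv ℝ v (y + t • e)) (y + t • e) :=
          ((hvΩ.contDiffAt (hopen.mem_nhds (hseg y hy t ht))).differentiableAt
            one_ne_zero).hasFDerivAt
        exact (hvd.comp_hasDerivAt t hline).norm_sq)
      (by
        have h2 := hvc.comp hline hmaps
        have h3 := (hfc.comp hline hmaps).clm_apply (continuousOn_const (c := e))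
        exact continuousOn_const.mul (h2.inner h3))
      (fun t ht => (hφ'b t ht).trans (by
        have hz := hseg y hy t ht
        have hvA := hA _ (subset_closure hz)
        have hvM := hMb _ hz
        have hA0 : 0 ≤ A := (norm_nonneg _).trans hvA
        gcongr))
    simp only [zero_smul, add_zero] at h1
    refine h1.trans ?_
    calc _ ≤ ∫⁻ t in Ioo 0 h, F (y + t • e) := by
          refine setLIntegral_mono' measurableSet_Ioo fun t ht => ?_
          rw [hF, indicator_of_mem (hseg y hy t ht)]
          refine ENNReal.ofReal_le_ofReal ?_
          rw [abs_of_nonneg (by positivity), traceDensity, mul_add]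
          refine add_le_add ?_ ((hφ'b t ht).trans ?_)
          · rw [div_eq_mul_one_div, mul_comm]
            gcongr
            exact le_max_left _ _
          · gcongr
            exact le_max_right _ _
      _ ≤ ∫⁻ t, F (y + t • e) := setLIntegral_le_lintegral _ _
      _ = ∫⁻ t : ℝ, F (y + t • EuclideanSpace.single i (1 : ℝ)) := by
          rw [← lintegral_smul_sign hσ fun t => F (y + t • EuclideanSpace.single i (1 : ℝ))]
          simp only [he, smul_smul]
  refine (lintegral_hausdorffMeasure_le
    (isClosed_frontier.measurableSet.inter isClosed_closedBall.measurableSet) hK hFm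
    hFline).trans_eq ?_
  rw [hF, lintegral_indicator hopen.measurableSet]
  simp_rw [ENNReal.ofReal_mul hc0.le]
  rw [lintegral_const_mul' _ _ ENNReal.ofReal_ne_top, ← mul_assoc, ENNReal.coe_mul,
    ENNReal.coe_rpow_of_nonneg _ n.cast_nonneg]
  rfl

open Filter Topology Metric in
/-- Trace inequality on a bounded domain with `C¹` boundary. -/
lemma exists_trace_le {n : ℕ} {V : Type*} [NormedAddCommGroup V] [InnerProductSpace ℝ V]
    {Ω : Set (EuclideanSpace ℝ (Fin (n + 1)))} (hopen : IsOpen Ω) (hbdd : Bornology.IsBounded Ω)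
    (hC1 : ∀ x ∈ frontier Ω, ∃ f : EuclideanSpace ℝ (Fin (n + 1)) → ℝ,
      ContDiffAt ℝ 1 f x ∧ fderiv ℝ f x ≠ 0 ∧ ∀ᶠ y in nhds x, (y ∈ Ω ↔ f y < 0)) :
    ∃ C : NNReal, ∀ v : EuclideanSpace ℝ (Fin (n + 1)) → V, ContDiffOn ℝ 1 v (closure Ω) →
      ∫⁻ y in frontier Ω, ENNReal.ofReal (‖v y‖ ^ 2) ∂μH[(n : ℝ)]
        ≤ C * ∫⁻ x in Ω, ENNReal.ofReal (traceDensity v x) := by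
  have hK : IsCompact (frontier Ω) :=
    hbdd.isCompact_closure.of_isClosed_subset isClosed_frontier frontier_subset_closure
  have key : ∃ C : NNReal, ∀ v : EuclideanSpace ℝ (Fin (n + 1)) → V, ContDiffOn ℝ 1 v (closure Ω) →
      ∫⁻ y in frontier Ω ∩ frontier Ω, ENNReal.ofReal (‖v y‖ ^ 2) ∂μH[(n : ℝ)]
        ≤ C * ∫⁻ x in Ω, ENNReal.ofReal (traceDensity v x) := by
    refine hK.induction_on (p := fun s => ∃ C : NNReal,
      ∀ v : EuclideanSpace ℝ (Fin (n + 1)) → V, ContDiffOn ℝ 1 v (closure Ω) →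
      ∫⁻ y in frontier Ω ∩ s, ENNReal.ofReal (‖v y‖ ^ 2) ∂μH[(n : ℝ)]
        ≤ C * ∫⁻ x in Ω, ENNReal.ofReal (traceDensity v x)) ⟨0, by simp⟩ ?_ ?_ ?_
    · rintro s t hst ⟨C, hC⟩
      exact ⟨C, fun v hv => (lintegral_mono_set (inter_subset_inter_right _ hst)).trans (hC v hv)⟩
    · rintro s t ⟨C, hC⟩ ⟨C', hC'⟩
      refine ⟨C + C', fun v hv => ?_⟩
      rw [inter_union_distrib_left, ENNReal.coe_add, add_mul]
      exact (lintegral_union_le _ _ _).trans (add_le_add (hC v hv) (hC' v hv))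
    · intro x hx
      obtain ⟨f, h1, h2, h3⟩ := hC1 x hx
      obtain ⟨r, hr, C, hC⟩ := exists_local_trace_le (V := V) hopen hbdd h1 h2 h3
      exact ⟨closedBall x r, mem_nhdsWithin_of_mem_nhds (closedBall_mem_nhds x hr), C, hC⟩
  simpa only [inter_self] using key
open Metric in
/-- Poincaré inequality for divergence-free fields tangent to the boundary: integrate the divergence
of `⟪x, v⟫ v`. -/
lemma integral_norm_sq_le_of_div_eq_zero {ι : Type*} [Fintype ι] [DecidableEq ι]
    {Ω : Set (EuclideanSpace ℝ ι)} (hopen : IsOpen Ω) (hbdd : Bornology.IsBounded Ω)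
    (hΩ : Ωᶜ.Nonempty) {R : ℝ} (hR : ∀ x ∈ Ω, ‖x‖ ≤ R)
    {v : EuclideanSpace ℝ ι → EuclideanSpace ℝ ι} (hv : ContDiffOn ℝ 1 v (closure Ω))
    (hdiv : ∀ x ∈ Ω, ∑ i, fderiv ℝ v x (EuclideanSpace.single i 1) i = 0)
    (htan : ∀ x ∈ Ω, ∀ y ∈ frontier Ω, ball x (dist x y) ⊆ Ω → inner ℝ (x - y) (v y) = 0) :
    IntegrableOn (fun x => ‖v x‖ ^ 2) Ω ∧ IntegrableOn (fun x => ‖v x‖ * ‖fderiv ℝ v x‖) Ω ∧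
      ∫ x in Ω, ‖v x‖ ^ 2 ≤ R * ∫ x in Ω, ‖v x‖ * ‖fderiv ℝ v x‖ := by
  have hvΩ : ContDiffOn ℝ 1 v Ω := hv.mono subset_closure
  have hvc : ContinuousOn v Ω := hvΩ.continuousOn
  have hfc : ContinuousOn (fderiv ℝ v) Ω := hvΩ.continuousOn_fderiv_of_isOpen hopen le_rfl
  obtain ⟨M, hM, hMb⟩ := exists_norm_fderiv_le_of_contDiffOn_closure hopen hbdd hv
  obtain ⟨A, hA⟩ := hbdd.isCompact_closure.exists_bound_of_continuousOn hv.continuousOn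
  have hvol : volume Ω < ∞ := hbdd.measure_lt_top
  have hi1 : IntegrableOn (fun x => ‖v x‖ ^ 2) Ω := by
    refine IntegrableOn.of_bound hvol
      (ContinuousOn.aestronglyMeasurable (by fun_prop) hopen.measurableSet) (A ^ 2)
      ((ae_restrict_iff' hopen.measurableSet).2 (ae_of_all _ fun x hx => ?_))
    have h1 := hA x (subset_closure hx)
    rw [Real.norm_of_nonneg (by positivity)]
    gcongr
  have hi2 : IntegrableOn (fun x => ‖v x‖ * ‖fderiv ℝ v x‖) Ω := by
    refine IntegrableOn.of_bound hvol
      (ContinuousOn.aestronglyMeasurable (by fun_prop) hopen.measurableSet) (A * M)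
      ((ae_restrict_iff' hopen.measurableSet).2 (ae_of_all _ fun x hx => ?_))
    have h1 := hA x (subset_closure hx)
    have h2 := hMb x hx
    have h3 : 0 ≤ A := (norm_nonneg _).trans h1
    rw [Real.norm_of_nonneg (by positivity)]
    gcongr
  refine ⟨hi1, hi2, ?_⟩
  have hw : ContDiffOn ℝ 1 (fun x => inner ℝ x (v x) • v x) (closure Ω) :=
    (contDiffOn_id.inner ℝ hv).smul hv
  obtain ⟨hi3, h0⟩ := integral_div_eq_zero_of_tangent hopen hbdd hΩ hw fun x hx y hy hb => by
    rw [inner_smul_right, htan x hx y hy hb, mul_zero]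
  have hcalc : ∀ x ∈ Ω, ∑ i, fderiv ℝ (fun x => inner ℝ x (v x) • v x) x
      (EuclideanSpace.single i 1) i = ‖v x‖ ^ 2 + inner ℝ x (fderiv ℝ v x (v x)) := by
    intro x hx
    have hd : HasFDerivAt v (fderiv ℝ v x) x :=
      ((hvΩ.contDiffAt (hopen.mem_nhds hx)).differentiableAt one_ne_zero).hasFDerivAt
    have hder : fderiv ℝ (fun x => inner ℝ x (v x) • v x) x = inner ℝ x (v x) • fderiv ℝ v x
        + ((fderivInnerCLM ℝ (x, v x)).comp
        ((ContinuousLinearMap.id ℝ (EuclideanSpace ℝ ι)).prod (fderiv ℝ v x))).smulRight (v x) :=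
      (((hasFDerivAt_id x).inner ℝ hd).smul hd).fderiv
    rw [hder]
    have hdv : inner ℝ x (fderiv ℝ v x (v x))
        = ∑ i, v x i * inner ℝ x (fderiv ℝ v x (EuclideanSpace.single i 1)) := by
      conv_lhs => rw [← (EuclideanSpace.basisFun ι ℝ).sum_repr (v x)]
      simp only [map_sum, map_smul, inner_sum, inner_smul_right, EuclideanSpace.basisFun_repr,
        EuclideanSpace.basisFun_apply]
    rw [hdv, EuclideanSpace.real_norm_sq_eq]
    have hterm : ∀ i, (inner ℝ x (v x) • fderiv ℝ v x + ((fderivInnerCLM ℝ (x, v x)).comp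
        ((ContinuousLinearMap.id ℝ (EuclideanSpace ℝ ι)).prod (fderiv ℝ v x))).smulRight (v x))
        (EuclideanSpace.single i 1) i
        = inner ℝ x (v x) * fderiv ℝ v x (EuclideanSpace.single i 1) i
          + (v x i ^ 2 + v x i * inner ℝ x (fderiv ℝ v x (EuclideanSpace.single i 1))) := by
      intro i
      have hsingle : inner ℝ (EuclideanSpace.single i 1) (v x) = v x i := by
        simp [EuclideanSpace.inner_single_left]
      simp [fderivInnerCLM_apply, hsingle]
      ring
    rw [Finset.sum_congr rfl fun i _ => hterm i, Finset.sum_add_distrib, ← Finset.mul_sum,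
      hdiv x hx, mul_zero, zero_add, Finset.sum_add_distrib]
  rw [← sub_nonneg, ← integral_const_mul, ← integral_sub (hi2.const_mul R) hi1]
  have hneg : 0 ≤ ∫ x in Ω, ((R * (‖v x‖ * ‖fderiv ℝ v x‖) - ‖v x‖ ^ 2)
      + ∑ i, fderiv ℝ (fun x => inner ℝ x (v x) • v x) x (EuclideanSpace.single i 1) i) := by
    refine setIntegral_nonneg hopen.measurableSet fun x hx => ?_
    rw [hcalc x hx]
    have h1 : |inner ℝ x (fderiv ℝ v x (v x))| ≤ R * (‖v x‖ * ‖fderiv ℝ v x‖) := by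
      refine (abs_real_inner_le_norm _ _).trans ?_
      have h2 := hR x hx
      have h3 : 0 ≤ R := (norm_nonneg _).trans h2
      gcongr
      rw [mul_comm]
      exact (fderiv ℝ v x).le_opNorm _
    have := neg_le_of_abs_le h1
    linarith
  have hi4 : IntegrableOn (fun x => R * (‖v x‖ * ‖fderiv ℝ v x‖) - ‖v x‖ ^ 2) Ω :=
    (hi2.const_mul R).sub hi1
  rwa [integral_add hi4 hi3, h0, add_zero] at hneg

lemma eLpNorm_two_eq {α E : Type*} [MeasurableSpace α] [NormedAddCommGroup E] (μ : Measure α)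
    (f : α → E) : eLpNorm f 2 μ = (∫⁻ x, ENNReal.ofReal (‖f x‖ ^ 2) ∂μ) ^ ((1 : ℝ) / 2) := by
  rw [eLpNorm_eq_lintegral_rpow_enorm_toReal two_ne_zero ENNReal.ofNat_ne_top]
  simp [ENNReal.ofReal_pow]

/-- Divergence-free trace inequality: on a bounded C² domain Ω ⊂ ℝ³, every
H¹ vector field v which is divergence free and tangent to the boundary
satisfies ‖v‖_{L²(∂Ω)} ≤ C ‖v‖_{L²(Ω)}^{1/2} ‖∇v‖_{L²(Ω)}^{1/2}. -/
theorem div_free_trace_inequality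
    (Ω : Set (EuclideanSpace ℝ (Fin 3)))
    (hopen : IsOpen Ω) (hbdd : Bornology.IsBounded Ω) (hne : Ω.Nonempty)
    (hC2 : ∀ x ∈ frontier Ω, ∃ f : EuclideanSpace ℝ (Fin 3) → ℝ,
      ContDiffAt ℝ 2 f x ∧ fderiv ℝ f x ≠ 0 ∧ ∀ᶠ y in nhds x, (y ∈ Ω ↔ f y < 0)) :
    ∃ C : ℝ, 0 < C ∧
      ∀ v : EuclideanSpace ℝ (Fin 3) → EuclideanSpace ℝ (Fin 3),
        ContDiffOn ℝ 1 v (closure Ω) →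
        (∀ x ∈ Ω, ∑ i : Fin 3, fderiv ℝ v x (EuclideanSpace.single i 1) i = 0) →
        (∀ x ∈ frontier Ω, ∀ f : EuclideanSpace ℝ (Fin 3) → ℝ,
          ContDiffAt ℝ 2 f x → fderiv ℝ f x ≠ 0 →
          (∀ᶠ y in nhds x, (y ∈ Ω ↔ f y < 0)) →
          fderiv ℝ f x (v x) = 0) →
        eLpNorm v 2 ((μH[(2 : ℝ)]).restrict (frontier Ω)) ≤
          ENNReal.ofReal C *
            (eLpNorm v 2 (volume.restrict Ω)) ^ ((1 : ℝ) / 2) *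
            (eLpNorm (fun x => ‖fderiv ℝ v x‖) 2 (volume.restrict Ω)) ^ ((1 : ℝ) / 2) := by
  obtain ⟨C, hC⟩ := exists_trace_le (V := EuclideanSpace ℝ (Fin 3)) hopen hbdd fun x hx => by
    obtain ⟨f, h1, h2, h3⟩ := hC2 x hx
    exact ⟨f, h1.of_le one_le_two, h2, h3⟩
  obtain ⟨R, hR0, hR⟩ := hbdd.exists_pos_norm_le
  have hΩ : Ωᶜ.Nonempty := nonempty_compl.2 fun h =>
    NormedSpace.unbounded_univ ℝ (EuclideanSpace ℝ (Fin 3)) (h ▸ hbdd)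
  set B : ℝ := (C + 1) * (R + 1) with hB
  have hB0 : 0 < B := by positivity
  refine ⟨B ^ ((1 : ℝ) / 2), by positivity, fun v hv hdiv htan => ?_⟩
  have hvΩ : ContDiffOn ℝ 1 v Ω := hv.mono subset_closure
  have hvc : ContinuousOn v Ω := hvΩ.continuousOn
  have hfc : ContinuousOn (fderiv ℝ v) Ω := hvΩ.continuousOn_fderiv_of_isOpen hopen le_rfl
  have hperp : ∀ x ∈ Ω, ∀ y ∈ frontier Ω, Metric.ball x (dist x y) ⊆ Ω →
      inner ℝ (x - y) (v y) = 0 := by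
    intro x _ y hy hball
    obtain ⟨f, h1, h2, h3⟩ := hC2 y hy
    have hyΩ : y ∉ Ω := fun h => by
      rw [hopen.frontier_eq] at hy
      exact hy.2 h
    exact inner_eq_zero_of_ball_subset hyΩ hball (h1.differentiableAt two_ne_zero) h2 h3
      (htan y hy f h1 h2 h3)
  obtain ⟨hi1, hi2, hP⟩ := integral_norm_sq_le_of_div_eq_zero hopen hbdd hΩ hR hv hdiv hperp
  have hmix : ∫⁻ x in Ω, ENNReal.ofReal (traceDensity v x)
      ≤ ENNReal.ofReal (R + 1) * ∫⁻ x in Ω, ENNReal.ofReal (‖v x‖ * ‖fderiv ℝ v x‖) := by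
    unfold traceDensity
    have hi3 : IntegrableOn (fun x => ‖v x‖ ^ 2 + ‖v x‖ * ‖fderiv ℝ v x‖) Ω := hi1.add hi2
    rw [← ofReal_integral_eq_lintegral_ofReal hi3 (ae_of_all _ fun x => by positivity),
      ← ofReal_integral_eq_lintegral_ofReal hi2 (ae_of_all _ fun x => by positivity),
      ← ENNReal.ofReal_mul (by positivity), integral_add hi1 hi2]
    exact ENNReal.ofReal_le_ofReal (by linarith)
  have hholder : ∫⁻ x in Ω, ENNReal.ofReal (‖v x‖ * ‖fderiv ℝ v x‖)
      ≤ eLpNorm v 2 (volume.restrict Ω)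
        * eLpNorm (fun x => ‖fderiv ℝ v x‖) 2 (volume.restrict Ω) := by
    have hm1 : AEMeasurable (fun x => ENNReal.ofReal ‖v x‖) (volume.restrict Ω) :=
      (hvc.norm.aemeasurable hopen.measurableSet).ennreal_ofReal
    have hm2 : AEMeasurable (fun x => ENNReal.ofReal ‖fderiv ℝ v x‖) (volume.restrict Ω) :=
      (hfc.norm.aemeasurable hopen.measurableSet).ennreal_ofReal
    have := ENNReal.lintegral_mul_le_Lp_mul_Lq (volume.restrict Ω)
      Real.HolderConjugate.two_two hm1 hm2
    rw [eLpNorm_two_eq, eLpNorm_two_eq]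
    simpa [ENNReal.ofReal_mul, ENNReal.ofReal_pow] using this
  have htrace := hC v hv
  rw [show ((2 : ℕ) : ℝ) = 2 by norm_num] at htrace
  rw [eLpNorm_two_eq, ← ENNReal.ofReal_rpow_of_pos hB0,
    ← ENNReal.mul_rpow_of_nonneg _ _ (by norm_num), ← ENNReal.mul_rpow_of_nonneg _ _ (by norm_num)]
  refine ENNReal.rpow_le_rpow ?_ (by norm_num)
  calc _ ≤ C * ∫⁻ x in Ω, ENNReal.ofReal (traceDensity v x) := htrace
    _ ≤ C * (ENNReal.ofReal (R + 1) * (eLpNorm v 2 (volume.restrict Ω)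
        * eLpNorm (fun x => ‖fderiv ℝ v x‖) 2 (volume.restrict Ω))) := by
      gcongr
      exact hmix.trans (by gcongr)
    _ ≤ ENNReal.ofReal (C + 1) * (ENNReal.ofReal (R + 1) * (eLpNorm v 2 (volume.restrict Ω)
        * eLpNorm (fun x => ‖fderiv ℝ v x‖) 2 (volume.restrict Ω))) := by
      gcongr
      rw [← ENNReal.ofReal_coe_nnreal]
      exact ENNReal.ofReal_le_ofReal (by linarith)
    _ = _ := by
      rw [hB, ENNReal.ofReal_mul (by positivity)]
      simp only [mul_assoc]
end
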